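/- arXiv:1504.01076 — 3 statements merged into one kernel-verified Lean document; each statement's English description precedes it below -/
import Mathlib

section
/- There exists a universal constant C > 0 with the following property. Let l ≥ 2 be an integer, Δ = 2^l, let 2 ≤ k ≤ Δ² be an integer, and let μ, ν : {0,…,Δ−1}² → ℝ≥0 each sum to 1, with |supp(μ)| ≤ k. If s is chosen uniformly at random from {0, 1, …, Δ−1}², then with probability at least 0.99, ‖G_s(μ − ν)‖₁ ≤ C·(log₂ k + log₂ log₂ Δ)·EMD(μ, ν). -/
open scoped Classical

/-- The cell of the grid `𝒢_{s,j}` (corner `s`, side `2^j`) containing a point `p`. -/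
noncomputable def cellOf (s : ℤ × ℤ) (j : ℕ) (p : ℝ × ℝ) : ℤ × ℤ :=
  (⌊(p.1 - (s.1 : ℝ)) / 2 ^ j⌋, ⌊(p.2 - (s.2 : ℝ)) / 2 ^ j⌋)

/-- A grid point of `{0,…,Δ−1}²` seen as a point of the plane. -/
noncomputable def toPlane {Δ : ℕ} (p : Fin Δ × Fin Δ) : ℝ × ℝ :=
  (((p.1 : ℕ) : ℝ), ((p.2 : ℕ) : ℝ))

/-- `‖G_s μ‖₁ = Σ_{j=0}^{l} 2^j Σ_{cells of 𝒢_{s,j}} |μ(cell)|`, the ℓ₁-norm of the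
grid embedding of a signed measure `μ` on `{0,…,2^l−1}²` with shift `s`. -/
noncomputable def gridEmbNorm (l : ℕ) (s : ℤ × ℤ) (μ : Fin (2 ^ l) × Fin (2 ^ l) → ℝ) : ℝ :=
  ∑ j ∈ Finset.range (l + 1), (2 : ℝ) ^ j *
    ∑ c ∈ Finset.univ.image (fun p : Fin (2 ^ l) × Fin (2 ^ l) => cellOf s j (toPlane p)),
      |∑ p ∈ Finset.univ.filter (fun p => cellOf s j (toPlane p) = c), μ p|

/-- The Earth Mover's Distance on `{0,…,Δ−1}²` with ground distance `‖p − q‖₁`: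
the infimum over couplings of the transportation cost. -/
noncomputable def EMDgrid (Δ : ℕ) (μ ν : Fin Δ × Fin Δ → ℝ) : ℝ :=
  sInf {c : ℝ | ∃ π : (Fin Δ × Fin Δ) → (Fin Δ × Fin Δ) → ℝ,
    (∀ p q, 0 ≤ π p q) ∧
    (∀ p, ∑ q, π p q = μ p) ∧
    (∀ q, ∑ p, π p q = ν q) ∧
    c = ∑ p, ∑ q, π p q *
      (|((p.1.1 : ℕ) : ℝ) - ((q.1.1 : ℕ) : ℝ)| + |((p.2.1 : ℕ) : ℝ) - ((q.2.1 : ℕ) : ℝ)|)}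

/-- Two points in different cells of a one-dimensional grid are separated by a grid point. -/
lemma exists_dvd_of_floor_ne {a b s : ℤ} (hab : a ≤ b) (j : ℕ)
    (h : ⌊((a : ℝ) - s) / 2 ^ j⌋ ≠ ⌊((b : ℝ) - s) / 2 ^ j⌋) :
    ∃ t ∈ Finset.Ioc a b, (2 : ℤ) ^ j ∣ t - s := by
  have hm : (0 : ℝ) < 2 ^ j := by positivity
  have hab' : (a : ℝ) ≤ b := by exact_mod_cast hab
  have hle : ⌊((a : ℝ) - s) / 2 ^ j⌋ ≤ ⌊((b : ℝ) - s) / 2 ^ j⌋ := by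
    apply Int.floor_mono
    gcongr
  have hlt := lt_of_le_of_ne hle h
  refine ⟨s + 2 ^ j * ⌊((b : ℝ) - s) / 2 ^ j⌋, ?_, ⟨_, add_sub_cancel_left _ _⟩⟩
  rw [Finset.mem_Ioc]
  constructor
  · have h1 : ((a : ℝ) - s) / 2 ^ j < (⌊((b : ℝ) - s) / 2 ^ j⌋ : ℝ) := by
      rwa [← Int.floor_lt]
    rw [div_lt_iff₀ hm] at h1
    have : (a : ℝ) < ((s + 2 ^ j * ⌊((b : ℝ) - s) / 2 ^ j⌋ : ℤ) : ℝ) := by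
      push_cast
      linarith
    exact_mod_cast this
  · have h1 := Int.floor_le (((b : ℝ) - s) / 2 ^ j)
    rw [le_div_iff₀ hm] at h1
    have : ((s + 2 ^ j * ⌊((b : ℝ) - s) / 2 ^ j⌋ : ℤ) : ℝ) ≤ b := by
      push_cast
      linarith
    exact_mod_cast this

lemma card_filter_dvd_le {l j : ℕ} (hj : j ≤ l) (t : ℤ) :
    (Finset.univ.filter fun s : Fin (2 ^ l) => (2 : ℤ) ^ j ∣ t - (s : ℕ)).card ≤ 2 ^ (l - j) := by
  have hl : 2 ^ l = 2 ^ (l - j) * 2 ^ j := by rw [← pow_add, Nat.sub_add_cancel hj]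
  rw [← Finset.card_range (2 ^ (l - j))]
  apply Finset.card_le_card_of_injOn (fun s : Fin (2 ^ l) => (s : ℕ) / 2 ^ j)
  · intro s _
    simp only [Finset.coe_range, Set.mem_Iio]
    rw [Nat.div_lt_iff_lt_mul (by positivity), ← hl]
    exact s.2
  · intro s hs s' hs' h
    simp only [Finset.coe_filter, Finset.mem_univ, true_and, Set.mem_ofPred_eq] at hs hs' h
    have h1 : ((2 ^ j : ℕ) : ℤ) ∣ ((s' : ℕ) : ℤ) - (s : ℕ) := by
      have := dvd_sub hs hs'
      push_cast
      rwa [sub_sub_sub_cancel_left] at this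
    have h2 : (s : ℕ) % 2 ^ j = s' % 2 ^ j := (Nat.modEq_iff_dvd).2 h1
    apply Fin.ext
    rw [← Nat.div_add_mod (s : ℕ) (2 ^ j), ← Nat.div_add_mod (s' : ℕ) (2 ^ j), h, h2]

/-- The number of shifts for which the grid of side `2 ^ j` has a point in `(x, y]`. -/
lemma card_filter_exists_dvd_le {l j : ℕ} (hj : j ≤ l) (x y : ℤ) :
    (Finset.univ.filter fun s : Fin (2 ^ l) =>
      ∃ t ∈ Finset.Ioc x y, (2 : ℤ) ^ j ∣ t - (s : ℕ)).card * 2 ^ j ≤ (y - x).toNat * 2 ^ l := by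
  have hl : 2 ^ l = 2 ^ (l - j) * 2 ^ j := by rw [← pow_add, Nat.sub_add_cancel hj]
  have hsub : (Finset.univ.filter fun s : Fin (2 ^ l) =>
      ∃ t ∈ Finset.Ioc x y, (2 : ℤ) ^ j ∣ t - (s : ℕ)) ⊆
      (Finset.Ioc x y).biUnion fun t =>
        Finset.univ.filter fun s : Fin (2 ^ l) => (2 : ℤ) ^ j ∣ t - (s : ℕ) := by
    intro s hs
    simpa using hs
  have h1 := (Finset.card_le_card hsub).trans
    (Finset.card_biUnion_le_card_mul _ _ _ fun t _ => card_filter_dvd_le hj t)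
  rw [Int.card_Ioc] at h1
  calc _ ≤ (y - x).toNat * 2 ^ (l - j) * 2 ^ j := Nat.mul_le_mul_right _ h1
    _ = _ := by rw [mul_assoc, ← hl]

lemma card_le_of_forall_fst_or_snd {α : Type*} [Fintype α] (A B : α → Prop)
    [DecidablePred A] [DecidablePred B] (S : Finset (α × α)) (h : ∀ s ∈ S, A s.1 ∨ B s.2) :
    S.card ≤ ((Finset.univ.filter A).card + (Finset.univ.filter B).card) * Fintype.card α := by
  have hsub : S ⊆ (Finset.univ.filter A ×ˢ Finset.univ) ∪ (Finset.univ ×ˢ Finset.univ.filter B) := by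
    intro s hs
    simpa using h s hs
  refine (Finset.card_le_card hsub).trans ((Finset.card_union_le _ _).trans ?_)
  rw [Finset.card_product, Finset.card_product, Finset.card_univ]
  apply le_of_eq
  ring

/-- The `ℓ₁` distance on the grid. -/
def gridDist {Δ : ℕ} (p q : Fin Δ × Fin Δ) : ℕ :=
  (((p.1 : ℕ) : ℤ) - ((q.1 : ℕ) : ℤ)).natAbs + (((p.2 : ℕ) : ℤ) - ((q.2 : ℕ) : ℤ)).natAbs

lemma cast_gridDist {Δ : ℕ} (p q : Fin Δ × Fin Δ) : (gridDist p q : ℝ) =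
    |((p.1.1 : ℕ) : ℝ) - ((q.1.1 : ℕ) : ℝ)| + |((p.2.1 : ℕ) : ℝ) - ((q.2.1 : ℕ) : ℝ)| := by
  simp [gridDist, Nat.cast_natAbs]

/-- `p` and `q` lie in different cells of the grid of side `2 ^ j` with corner `s`. -/
def Separated {l : ℕ} (s : Fin (2 ^ l) × Fin (2 ^ l)) (j : ℕ)
    (p q : Fin (2 ^ l) × Fin (2 ^ l)) : Prop :=
  cellOf ((s.1 : ℤ), (s.2 : ℤ)) j (toPlane p) ≠ cellOf ((s.1 : ℤ), (s.2 : ℤ)) j (toPlane q)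

/-- Some line of the grid of side `2 ^ j` with corner `s` passes within distance `r` of `p`. -/
def NearBoundary {l : ℕ} (s : Fin (2 ^ l) × Fin (2 ^ l)) (j r : ℕ)
    (p : Fin (2 ^ l) × Fin (2 ^ l)) : Prop :=
  (∃ t ∈ Finset.Ioc ((p.1 : ℤ) - r) ((p.1 : ℤ) + r), (2 : ℤ) ^ j ∣ t - (s.1 : ℕ)) ∨
    ∃ t ∈ Finset.Ioc ((p.2 : ℤ) - r) ((p.2 : ℤ) + r), (2 : ℤ) ^ j ∣ t - (s.2 : ℕ)

lemma exists_dvd_of_floor_ne' {a b s j : ℕ}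
    (h : ⌊((a : ℝ) - ((s : ℤ) : ℝ)) / 2 ^ j⌋ ≠ ⌊((b : ℝ) - ((s : ℤ) : ℝ)) / 2 ^ j⌋) :
    ∃ t ∈ Finset.Ioc (min (a : ℤ) b) (max (a : ℤ) b), (2 : ℤ) ^ j ∣ t - s := by
  rcases le_total (a : ℤ) b with hab | hab
  · rw [min_eq_left hab, max_eq_right hab]
    exact exists_dvd_of_floor_ne hab j (by simpa using h)
  · rw [min_eq_right hab, max_eq_left hab]
    exact exists_dvd_of_floor_ne hab j (by simpa using h.symm)

lemma Separated.exists_dvd {l j : ℕ} {s p q : Fin (2 ^ l) × Fin (2 ^ l)}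
    (h : Separated s j p q) :
    (∃ t ∈ Finset.Ioc (min (p.1 : ℤ) q.1) (max (p.1 : ℤ) q.1), (2 : ℤ) ^ j ∣ t - (s.1 : ℕ)) ∨
      ∃ t ∈ Finset.Ioc (min (p.2 : ℤ) q.2) (max (p.2 : ℤ) q.2), (2 : ℤ) ^ j ∣ t - (s.2 : ℕ) := by
  unfold Separated cellOf toPlane at h
  rw [Ne, Prod.mk.injEq, not_and_or] at h
  exact h.imp (fun h => exists_dvd_of_floor_ne' h) (fun h => exists_dvd_of_floor_ne' h)

lemma Separated.nearBoundary {l j r : ℕ} {s p q : Fin (2 ^ l) × Fin (2 ^ l)}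
    (h : Separated s j p q) (hr : gridDist p q ≤ r) : NearBoundary s j r p := by
  unfold gridDist at hr
  refine h.exists_dvd.imp ?_ ?_ <;>
  · rintro ⟨t, ht, hdvd⟩
    refine ⟨t, ?_, hdvd⟩
    rw [Finset.mem_Ioc] at ht ⊢
    omega

lemma card_separated_le {l j : ℕ} (hj : j ≤ l) (p q : Fin (2 ^ l) × Fin (2 ^ l)) :
    (Finset.univ.filter fun s => Separated s j p q).card * 2 ^ j ≤
      gridDist p q * (2 ^ l) ^ 2 := by
  have h1 := card_le_of_forall_fst_or_snd
    (fun s : Fin (2 ^ l) => ∃ t ∈ Finset.Ioc (min (p.1 : ℤ) q.1) (max (p.1 : ℤ) q.1),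
      (2 : ℤ) ^ j ∣ t - (s : ℕ))
    (fun s : Fin (2 ^ l) => ∃ t ∈ Finset.Ioc (min (p.2 : ℤ) q.2) (max (p.2 : ℤ) q.2),
      (2 : ℤ) ^ j ∣ t - (s : ℕ))
    (Finset.univ.filter fun s => Separated s j p q)
    fun s hs => (Finset.mem_filter.1 hs).2.exists_dvd
  have h2 := card_filter_exists_dvd_le hj (min (p.1 : ℤ) q.1) (max (p.1 : ℤ) q.1)
  have h3 := card_filter_exists_dvd_le hj (min (p.2 : ℤ) q.2) (max (p.2 : ℤ) q.2)
  have e1 : (max (p.1 : ℤ) q.1 - min (p.1 : ℤ) q.1).toNat = ((p.1 : ℤ) - q.1).natAbs := by omega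
  have e2 : (max (p.2 : ℤ) q.2 - min (p.2 : ℤ) q.2).toNat = ((p.2 : ℤ) - q.2).natAbs := by omega
  rw [e1] at h2
  rw [e2] at h3
  rw [Fintype.card_fin] at h1
  refine (Nat.mul_le_mul_right _ h1).trans ?_
  unfold gridDist
  calc _ = _ := by rw [mul_right_comm, add_mul]
    _ ≤ _ := Nat.mul_le_mul_right _ (add_le_add h2 h3)
    _ = _ := by ring

lemma card_nearBoundary_le {l j : ℕ} (hj : j ≤ l) (r : ℕ) (p : Fin (2 ^ l) × Fin (2 ^ l)) :
    (Finset.univ.filter fun s => NearBoundary s j r p).card * 2 ^ j ≤ 4 * r * (2 ^ l) ^ 2 := by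
  have h1 := card_le_of_forall_fst_or_snd
    (fun s : Fin (2 ^ l) => ∃ t ∈ Finset.Ioc ((p.1 : ℤ) - r) ((p.1 : ℤ) + r),
      (2 : ℤ) ^ j ∣ t - (s : ℕ))
    (fun s : Fin (2 ^ l) => ∃ t ∈ Finset.Ioc ((p.2 : ℤ) - r) ((p.2 : ℤ) + r),
      (2 : ℤ) ^ j ∣ t - (s : ℕ))
    (Finset.univ.filter fun s => NearBoundary s j r p)
    fun s hs => (Finset.mem_filter.1 hs).2
  have h2 := card_filter_exists_dvd_le hj ((p.1 : ℤ) - r) ((p.1 : ℤ) + r)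
  have h3 := card_filter_exists_dvd_le hj ((p.2 : ℤ) - r) ((p.2 : ℤ) + r)
  have e1 : ((p.1 : ℤ) + r - ((p.1 : ℤ) - r)).toNat = 2 * r := by omega
  have e2 : ((p.2 : ℤ) + r - ((p.2 : ℤ) - r)).toNat = 2 * r := by omega
  rw [e1] at h2
  rw [e2] at h3
  rw [Fintype.card_fin] at h1
  refine (Nat.mul_le_mul_right _ h1).trans ?_
  calc _ = _ := by rw [mul_right_comm, add_mul]
    _ ≤ _ := Nat.mul_le_mul_right _ (add_le_add h2 h3)
    _ = _ := by ring

/-- With `r = 2 ^ j / R`, a union bound over the levels and over the points of `S`. -/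
lemma card_exists_nearBoundary_le (l R : ℕ) (hR : 0 < R) (S : Finset (Fin (2 ^ l) × Fin (2 ^ l))) :
    (Finset.univ.filter fun s => ∃ p ∈ S, ∃ j ∈ Finset.range (l + 1),
      NearBoundary s j (2 ^ j / R) p).card * R ≤ S.card * (l + 1) * (4 * (2 ^ l) ^ 2) := by
  have hone : ∀ x ∈ S ×ˢ Finset.range (l + 1),
      (Finset.univ.filter fun s => NearBoundary s x.2 (2 ^ x.2 / R) x.1).card ≤
        4 * (2 ^ l) ^ 2 / R := by
    intro x hx
    rw [Finset.mem_product, Finset.mem_range] at hx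
    have h := card_nearBoundary_le (by omega : x.2 ≤ l) (2 ^ x.2 / R) x.1
    rw [Nat.le_div_iff_mul_le hR]
    refine Nat.le_of_mul_le_mul_right ?_ (by positivity : 0 < 2 ^ x.2)
    calc _ = (Finset.univ.filter fun s => NearBoundary s x.2 (2 ^ x.2 / R) x.1).card
            * 2 ^ x.2 * R := by ring
      _ ≤ 4 * (2 ^ x.2 / R) * (2 ^ l) ^ 2 * R := Nat.mul_le_mul_right _ h
      _ = 4 * (2 ^ l) ^ 2 * (2 ^ x.2 / R * R) := by ring
      _ ≤ _ := Nat.mul_le_mul_left _ (Nat.div_mul_le_self _ _)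
  have hsub : (Finset.univ.filter fun s => ∃ p ∈ S, ∃ j ∈ Finset.range (l + 1),
      NearBoundary s j (2 ^ j / R) p) ⊆ (S ×ˢ Finset.range (l + 1)).biUnion fun x =>
        Finset.univ.filter fun s => NearBoundary s x.2 (2 ^ x.2 / R) x.1 := by
    intro s hs
    obtain ⟨p, hp, j, hj, h⟩ := (Finset.mem_filter.1 hs).2
    exact Finset.mem_biUnion.2 ⟨(p, j), Finset.mem_product.2 ⟨hp, hj⟩, by simpa using h⟩
  have h1 := (Finset.card_le_card hsub).trans (Finset.card_biUnion_le_card_mul _ _ _ hone)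
  rw [Finset.card_product, Finset.card_range] at h1
  calc _ ≤ S.card * (l + 1) * (4 * (2 ^ l) ^ 2 / R) * R := Nat.mul_le_mul_right _ h1
    _ = S.card * (l + 1) * (4 * (2 ^ l) ^ 2 / R * R) := by ring
    _ ≤ _ := Nat.mul_le_mul_left _ (Nat.div_mul_le_self _ _)

/-- A coupling of two measures controls the `ℓ₁` distance of their images under `g`. -/
lemma sum_abs_fiber_sub_le {P T : Type*} [Fintype P] (g : P → T) (μ ν : P → ℝ)
    (π : P → P → ℝ) (h0 : ∀ p q, 0 ≤ π p q) (hμ : ∀ p, ∑ q, π p q = μ p)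
    (hν : ∀ q, ∑ p, π p q = ν q) :
    ∑ c ∈ Finset.univ.image g, |∑ p ∈ Finset.univ.filter (fun p => g p = c), (μ p - ν p)| ≤
      ∑ p, ∑ q, π p q * (if g p ≠ g q then 2 else 0) := by
  have key : ∀ c, ∑ p ∈ Finset.univ.filter (fun p => g p = c), (μ p - ν p) =
      ∑ p, ∑ q, π p q * ((if g p = c then 1 else 0) - (if g q = c then 1 else 0)) := by
    intro c
    simp only [mul_sub, Finset.sum_sub_distrib]
    congr 1
    · rw [Finset.sum_filter]
      refine Finset.sum_congr rfl fun p _ => ?_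
      rw [← Finset.sum_mul, hμ]
      split_ifs <;> simp
    · rw [Finset.sum_filter, Finset.sum_comm]
      refine Finset.sum_congr rfl fun q _ => ?_
      rw [← Finset.sum_mul, hν]
      split_ifs <;> simp
  have habs : ∀ c, |∑ p ∈ Finset.univ.filter (fun p => g p = c), (μ p - ν p)| ≤
      ∑ p, ∑ q, π p q * |(if g p = c then (1 : ℝ) else 0) - (if g q = c then 1 else 0)| := by
    intro c
    rw [key]
    refine (Finset.abs_sum_le_sum_abs _ _).trans (Finset.sum_le_sum fun p _ => ?_)
    refine (Finset.abs_sum_le_sum_abs _ _).trans (Finset.sum_le_sum fun q _ => ?_)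
    rw [abs_mul, abs_of_nonneg (h0 p q)]
  refine (Finset.sum_le_sum fun c _ => habs c).trans ?_
  rw [Finset.sum_comm]
  refine Finset.sum_le_sum fun p _ => ?_
  rw [Finset.sum_comm]
  refine Finset.sum_le_sum fun q _ => ?_
  rw [← Finset.mul_sum]
  refine mul_le_mul_of_nonneg_left ?_ (h0 p q)
  by_cases h : g p = g q
  · simp [h]
  · rw [if_pos h]
    calc _ ≤ ∑ c ∈ Finset.univ.image g,
          ((if g p = c then (1 : ℝ) else 0) + (if g q = c then 1 else 0)) := by
            refine Finset.sum_le_sum fun c _ => ?_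
            split_ifs <;> norm_num
      _ = 2 := by
        rw [Finset.sum_add_distrib]
        simp
        norm_num

/-- Only `m` scales exceed `d` below the cutoff `2 ^ m * d`. -/
lemma sum_min_two_pow_le (n m d : ℕ) :
    ∑ j ∈ (Finset.range n).filter (fun j => 2 ^ j < 2 ^ m * d), min (2 ^ j) d ≤ (m + 2) * d := by
  rcases Nat.eq_zero_or_pos d with rfl | hd
  · simp
  set e := Nat.log 2 d with he
  have h1 : 2 ^ e ≤ d := Nat.pow_log_le_self 2 hd.ne'
  have h2 : d < 2 ^ (e + 1) := Nat.lt_pow_succ_log_self (by norm_num) d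
  have hsub : (Finset.range n).filter (fun j => 2 ^ j < 2 ^ m * d) ⊆
      Finset.range (e + 1 + m) := by
    intro j hj
    rw [Finset.mem_filter] at hj
    rw [Finset.mem_range]
    rw [← Nat.pow_lt_pow_iff_right (by norm_num : 1 < 2)]
    calc 2 ^ j < 2 ^ m * d := hj.2
      _ ≤ 2 ^ m * 2 ^ (e + 1) := Nat.mul_le_mul_left _ h2.le
      _ = _ := by ring
  refine (Finset.sum_le_sum_of_subset hsub).trans ?_
  rw [Finset.sum_range_add]
  have h3 : ∑ j ∈ Finset.range (e + 1), min (2 ^ j) d ≤ 2 * d := by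
    calc _ ≤ ∑ j ∈ Finset.range (e + 1), 2 ^ j := Finset.sum_le_sum fun j _ => min_le_left _ _
      _ ≤ 2 ^ (e + 1) := by rw [Nat.geomSum_eq le_rfl]; simp
      _ ≤ _ := by rw [pow_succ]; omega
  have h4 : ∑ j ∈ Finset.range m, min (2 ^ (e + 1 + j)) d ≤ m * d := by
    calc _ ≤ ∑ j ∈ Finset.range m, d := Finset.sum_le_sum fun j _ => min_le_right _ _
      _ = _ := by simp
  linarith

/-- The part of the embedding cost of a coupling coming from scales below the cutoff. -/
noncomputable def truncatedCost {l : ℕ} (m : ℕ)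
    (π : (Fin (2 ^ l) × Fin (2 ^ l)) → (Fin (2 ^ l) × Fin (2 ^ l)) → ℝ)
    (s : Fin (2 ^ l) × Fin (2 ^ l)) : ℝ :=
  ∑ p, ∑ q, π p q * ∑ j ∈ (Finset.range (l + 1)).filter (fun j => 2 ^ j < 2 ^ m * gridDist p q),
    2 ^ j * (if Separated s j p q then 2 else 0)

lemma truncatedCost_nonneg {l m : ℕ}
    {π : (Fin (2 ^ l) × Fin (2 ^ l)) → (Fin (2 ^ l) × Fin (2 ^ l)) → ℝ}
    (h0 : ∀ p q, 0 ≤ π p q) (s : Fin (2 ^ l) × Fin (2 ^ l)) : 0 ≤ truncatedCost m π s := by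
  refine Finset.sum_nonneg fun p _ => Finset.sum_nonneg fun q _ => mul_nonneg (h0 p q) ?_
  refine Finset.sum_nonneg fun j _ => ?_
  split_ifs <;> positivity

lemma gridEmbNorm_le_truncatedCost {l m : ℕ} {μ ν : Fin (2 ^ l) × Fin (2 ^ l) → ℝ}
    {π : (Fin (2 ^ l) × Fin (2 ^ l)) → (Fin (2 ^ l) × Fin (2 ^ l)) → ℝ}
    (h0 : ∀ p q, 0 ≤ π p q) (hμ : ∀ p, ∑ q, π p q = μ p) (hν : ∀ q, ∑ p, π p q = ν q)
    {s : Fin (2 ^ l) × Fin (2 ^ l)}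
    (hs : ¬ ∃ p ∈ Finset.univ.filter (fun p => μ p ≠ 0), ∃ j ∈ Finset.range (l + 1),
      NearBoundary s j (2 ^ j / 2 ^ m) p) :
    gridEmbNorm l ((s.1 : ℤ), (s.2 : ℤ)) (fun p => μ p - ν p) ≤ truncatedCost m π s := by
  have h1 : gridEmbNorm l ((s.1 : ℤ), (s.2 : ℤ)) (fun p => μ p - ν p) ≤
      ∑ j ∈ Finset.range (l + 1), (2 : ℝ) ^ j *
        ∑ p, ∑ q, π p q * (if Separated s j p q then 2 else 0) := by
    unfold gridEmbNorm
    refine Finset.sum_le_sum fun j _ => mul_le_mul_of_nonneg_left ?_ (by positivity)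
    have h := sum_abs_fiber_sub_le
      (fun p : Fin (2 ^ l) × Fin (2 ^ l) => cellOf ((s.1 : ℤ), (s.2 : ℤ)) j (toPlane p))
      μ ν π h0 hμ hν
    refine (le_of_eq ?_).trans (h.trans (le_of_eq ?_))
    · congr!
    · unfold Separated
      congr!
  refine h1.trans ?_
  unfold truncatedCost
  simp_rw [Finset.mul_sum]
  rw [Finset.sum_comm]
  refine Finset.sum_le_sum fun p _ => ?_
  rw [Finset.sum_comm]
  refine Finset.sum_le_sum fun q _ => ?_
  rw [Finset.sum_filter]
  refine Finset.sum_le_sum fun j hj => ?_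
  split_ifs with hsep hlt hlt
  · apply le_of_eq
    ring
  · have hp : μ p = 0 := by
      by_contra hp
      refine hs ⟨p, by simpa using hp, j, hj, hsep.nearBoundary ?_⟩
      rw [Nat.le_div_iff_mul_le (by positivity), mul_comm]
      exact not_lt.1 hlt
    have hpq : π p q = 0 :=
      (Finset.sum_eq_zero_iff_of_nonneg fun q _ => h0 p q).1 ((hμ p).trans hp) q
        (Finset.mem_univ q)
    simp [hpq]
  · simp
  · simp

lemma sum_truncatedCost_le {l : ℕ} (m : ℕ)
    {π : (Fin (2 ^ l) × Fin (2 ^ l)) → (Fin (2 ^ l) × Fin (2 ^ l)) → ℝ}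
    (h0 : ∀ p q, 0 ≤ π p q) :
    ∑ s, truncatedCost m π s ≤
      2 * (m + 2) * (∑ p, ∑ q, π p q * (gridDist p q : ℝ)) * ((2 : ℝ) ^ l) ^ 2 := by
  unfold truncatedCost
  rw [Finset.sum_comm, Finset.mul_sum, Finset.sum_mul]
  refine Finset.sum_le_sum fun p _ => ?_
  rw [Finset.sum_comm, Finset.mul_sum, Finset.sum_mul]
  refine Finset.sum_le_sum fun q _ => ?_
  rw [← Finset.mul_sum]
  have hmain : (∑ s, ∑ j ∈ (Finset.range (l + 1)).filter
      (fun j => 2 ^ j < 2 ^ m * gridDist p q),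
        (2 : ℝ) ^ j * (if Separated s j p q then 2 else 0)) ≤
      2 * ((m + 2) * gridDist p q) * ((2 : ℝ) ^ l) ^ 2 := by
    rw [Finset.sum_comm]
    have hj : ∀ j ∈ (Finset.range (l + 1)).filter (fun j => 2 ^ j < 2 ^ m * gridDist p q),
        ∑ s, (2 : ℝ) ^ j * (if Separated s j p q then 2 else 0) ≤
          2 * ((2 : ℝ) ^ l) ^ 2 * ((min (2 ^ j) (gridDist p q) : ℕ) : ℝ) := by
      intro j hj
      rw [Finset.mem_filter, Finset.mem_range] at hj
      have h1 := card_separated_le (by omega : j ≤ l) p q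
      have h2 : (Finset.univ.filter fun s => Separated s j p q).card * 2 ^ j ≤
          2 ^ j * (2 ^ l) ^ 2 := by
        rw [mul_comm]
        refine Nat.mul_le_mul_left _ ((Finset.card_le_univ _).trans ?_)
        simp [sq]
      have h3 : (Finset.univ.filter fun s => Separated s j p q).card * 2 ^ j ≤
          min (2 ^ j) (gridDist p q) * (2 ^ l) ^ 2 := by
        rcases min_choice (2 ^ j) (gridDist p q) with h | h <;> rw [h]
        exacts [h2, h1]
      have h4 : ((Finset.univ.filter fun s => Separated s j p q).card : ℝ) * 2 ^ j ≤
          ((min (2 ^ j) (gridDist p q) : ℕ) : ℝ) * (2 ^ l) ^ 2 := by exact_mod_cast h3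
      rw [← Finset.mul_sum, ← Finset.sum_filter, Finset.sum_const, nsmul_eq_mul]
      linarith
    refine (Finset.sum_le_sum hj).trans ?_
    rw [← Finset.mul_sum, ← Nat.cast_sum]
    have h5 : ((∑ j ∈ (Finset.range (l + 1)).filter (fun j => 2 ^ j < 2 ^ m * gridDist p q),
        min (2 ^ j) (gridDist p q) : ℕ) : ℝ) ≤ (m + 2) * gridDist p q := by
      exact_mod_cast sum_min_two_pow_le (l + 1) m (gridDist p q)
    calc _ ≤ 2 * ((2 : ℝ) ^ l) ^ 2 * ((m + 2) * gridDist p q) :=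
          mul_le_mul_of_nonneg_left h5 (by positivity)
      _ = _ := by ring
  refine (mul_le_mul_of_nonneg_left hmain (h0 p q)).trans (le_of_eq ?_)
  ring

/-- Markov's inequality for the counting measure, in a form that allows `a = 0`. -/
lemma card_filter_lt_mul_le {α : Type*} [Fintype α] {X : α → ℝ} (hX : ∀ s, 0 ≤ X s) {a N t : ℝ}
    (hN : 0 ≤ N) (ha : 0 ≤ a) (h : ∑ s, X s ≤ a * N) :
    ((Finset.univ.filter fun s => t * a < X s).card : ℝ) * t ≤ N := by
  rcases ha.eq_or_lt with rfl | ha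
  · rw [zero_mul] at h
    have hz : ∀ s, X s = 0 := fun s =>
      (Finset.sum_eq_zero_iff_of_nonneg fun s _ => hX s).1
        (le_antisymm h (Finset.sum_nonneg fun s _ => hX s)) s (Finset.mem_univ s)
    simpa [hz] using hN
  · have h1 : ((Finset.univ.filter fun s => t * a < X s).card : ℝ) * (t * a) ≤ ∑ s, X s := by
      rw [← nsmul_eq_mul]
      refine (Finset.card_nsmul_le_sum _ _ _ fun s hs => (Finset.mem_filter.1 hs).2.le).trans ?_
      exact Finset.sum_le_sum_of_subset_of_nonneg (Finset.filter_subset _ _) fun s _ _ => hX s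
    refine le_of_mul_le_mul_right ?_ ha
    linarith

lemma card_gridEmbNorm_le_coupling {l k m : ℕ} (hm : 800 * k * (l + 1) ≤ 2 ^ m)
    {μ ν : Fin (2 ^ l) × Fin (2 ^ l) → ℝ}
    (hk : (Finset.univ.filter fun p => μ p ≠ 0).card ≤ k)
    {π : (Fin (2 ^ l) × Fin (2 ^ l)) → (Fin (2 ^ l) × Fin (2 ^ l)) → ℝ}
    (h0 : ∀ p q, 0 ≤ π p q) (hμ : ∀ p, ∑ q, π p q = μ p) (hν : ∀ q, ∑ p, π p q = ν q) :
    (0.99 : ℝ) * ((2 : ℝ) ^ l) ^ 2 ≤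
      ((Finset.univ.filter fun s : Fin (2 ^ l) × Fin (2 ^ l) =>
        gridEmbNorm l ((s.1 : ℤ), (s.2 : ℤ)) (fun p => μ p - ν p) ≤
          200 * (2 * (m + 2) * ∑ p, ∑ q, π p q * (gridDist p q : ℝ))).card : ℝ) := by
  set c := ∑ p, ∑ q, π p q * (gridDist p q : ℝ) with hc
  have hc0 : 0 ≤ c := Finset.sum_nonneg fun p _ => Finset.sum_nonneg fun q _ =>
    mul_nonneg (h0 p q) (Nat.cast_nonneg _)
  set G := Finset.univ.filter fun s : Fin (2 ^ l) × Fin (2 ^ l) =>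
    gridEmbNorm l ((s.1 : ℤ), (s.2 : ℤ)) (fun p => μ p - ν p) ≤ 200 * (2 * (m + 2) * c) with hG
  set B₁ := Finset.univ.filter fun s : Fin (2 ^ l) × Fin (2 ^ l) =>
    ∃ p ∈ Finset.univ.filter (fun p => μ p ≠ 0), ∃ j ∈ Finset.range (l + 1),
      NearBoundary s j (2 ^ j / 2 ^ m) p with hB₁
  set B₂ := Finset.univ.filter fun s : Fin (2 ^ l) × Fin (2 ^ l) =>
    200 * (2 * (m + 2) * c) < truncatedCost m π s with hB₂
  have hcover : Finset.univ ⊆ G ∪ (B₁ ∪ B₂) := by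
    intro s _
    by_cases h1 : s ∈ B₁
    · simp [h1]
    by_cases h2 : s ∈ B₂
    · simp [h2]
    refine Finset.mem_union_left _ (Finset.mem_filter.2 ⟨Finset.mem_univ s, ?_⟩)
    have h1' := fun h => h1 (Finset.mem_filter.2 ⟨Finset.mem_univ s, h⟩)
    have h2' := fun h => h2 (Finset.mem_filter.2 ⟨Finset.mem_univ s, h⟩)
    exact (gridEmbNorm_le_truncatedCost h0 hμ hν h1').trans (not_lt.1 h2')
  have hcard : ((2 : ℝ) ^ l) ^ 2 ≤ G.card + (B₁.card + B₂.card) := by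
    have h1 := (Finset.card_le_card hcover).trans
      ((Finset.card_union_le _ _).trans (Nat.add_le_add_left (Finset.card_union_le _ _) _))
    rw [Finset.card_univ, Fintype.card_prod, Fintype.card_fin, ← sq] at h1
    exact_mod_cast h1
  have hcard₂ : (B₂.card : ℝ) * 200 ≤ ((2 : ℝ) ^ l) ^ 2 :=
    card_filter_lt_mul_le (truncatedCost_nonneg h0) (by positivity)
      (by positivity) (sum_truncatedCost_le m h0)
  have hcard₁ : (B₁.card : ℝ) * 200 ≤ ((2 : ℝ) ^ l) ^ 2 := by
    have h1 := card_exists_nearBoundary_le l (2 ^ m) (by positivity)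
      (Finset.univ.filter fun p => μ p ≠ 0)
    have h2 : B₁.card * 200 * 2 ^ m ≤ (2 ^ l) ^ 2 * 2 ^ m := by
      calc B₁.card * 200 * 2 ^ m = B₁.card * 2 ^ m * 200 := by ring
        _ ≤ (Finset.univ.filter fun p => μ p ≠ 0).card * (l + 1) * (4 * (2 ^ l) ^ 2) * 200 :=
          Nat.mul_le_mul_right _ h1
        _ ≤ k * (l + 1) * (4 * (2 ^ l) ^ 2) * 200 := by gcongr
        _ = (2 ^ l) ^ 2 * (800 * k * (l + 1)) := by ring
        _ ≤ _ := Nat.mul_le_mul_left _ hm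
    exact_mod_cast Nat.le_of_mul_le_mul_right h2 (by positivity)
  linarith

lemma log_two_mul_add_three_le {k l : ℕ} (hk : 2 ≤ k) (hl : 2 ≤ l) :
    ((Nat.log 2 (800 * k * (l + 1)) : ℝ) + 3) ≤ 8 * (Real.logb 2 k + Real.logb 2 l) := by
  have hk' : (2 : ℝ) ≤ k := by exact_mod_cast hk
  have hl' : (2 : ℝ) ≤ l := by exact_mod_cast hl
  have h1 : (1 : ℝ) ≤ Real.logb 2 k := by
    rw [Real.le_logb_iff_rpow_le (by norm_num) (by linarith)]
    simpa using hk'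
  have h2 : (1 : ℝ) ≤ Real.logb 2 l := by
    rw [Real.le_logb_iff_rpow_le (by norm_num) (by linarith)]
    simpa using hl'
  have h3 : (Nat.log 2 (800 * k * (l + 1)) : ℝ) ≤ Real.logb 2 (2 ^ 11 * (k * l)) := by
    rw [Real.le_logb_iff_rpow_le (by norm_num) (by positivity), Real.rpow_natCast]
    have h4 : 2 ^ Nat.log 2 (800 * k * (l + 1)) ≤ 800 * k * (l + 1) :=
      Nat.pow_log_le_self 2 (by positivity)
    have h5 : 800 * k * (l + 1) ≤ 2 ^ 11 * (k * l) := by nlinarith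
    exact_mod_cast h4.trans h5
  rw [Real.logb_mul (by positivity) (by positivity), Real.logb_mul (by positivity) (by positivity),
    Real.logb_pow, Real.logb_self_eq_one (by norm_num)] at h3
  push_cast at h3
  linarith

/-- Lemma `grid_sparse`: if `μ, ν` are probability measures on `{0,…,Δ−1}²` (`Δ = 2^l`)
and `μ` is `k`-sparse, then for a uniformly random shift `s ∈ {0,…,Δ−1}²`, with probability
at least `0.99`, `‖G_s(μ − ν)‖₁ ≤ O(log k + log log Δ) ⋅ EMD(μ, ν)`. -/
theorem stmt_7 : ∃ C : ℝ, 0 < C ∧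
    ∀ (l k : ℕ), 2 ≤ l → 2 ≤ k → k ≤ (2 ^ l) ^ 2 →
    ∀ μ ν : Fin (2 ^ l) × Fin (2 ^ l) → ℝ,
      (∀ p, 0 ≤ μ p) → (∀ p, 0 ≤ ν p) →
      (∑ p, μ p = 1) → (∑ p, ν p = 1) →
      (Finset.univ.filter fun p => μ p ≠ 0).card ≤ k →
      (0.99 : ℝ) ≤
        ((Finset.univ.filter fun s : Fin (2 ^ l) × Fin (2 ^ l) =>
            gridEmbNorm l ((s.1 : ℤ), (s.2 : ℤ)) (fun p => μ p - ν p) ≤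
              C * (Real.logb 2 k + Real.logb 2 (Real.logb 2 ((2 : ℝ) ^ l))) *
                EMDgrid (2 ^ l) μ ν).card : ℝ) / ((2 : ℝ) ^ l) ^ 2 := by
  refine ⟨3200, by norm_num, fun l k hl hk _ μ ν hμ0 hν0 hμ1 hν1 hsupp => ?_⟩
  rw [le_div_iff₀ (by positivity), Real.logb_pow, Real.logb_self_eq_one (by norm_num), mul_one]
  set D := EMDgrid (2 ^ l) μ ν with hD
  set L := Real.logb 2 k + Real.logb 2 l with hL
  set m := Nat.log 2 (800 * k * (l + 1)) + 1 with hm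
  have hmL : (m : ℝ) + 2 ≤ 8 * L := by
    have := log_two_mul_add_three_le hk hl
    rw [hm]
    push_cast
    linarith
  have hm2 : (0 : ℝ) < m + 2 := by positivity
  have hm800 : 800 * k * (l + 1) ≤ 2 ^ m := (Nat.lt_pow_succ_log_self (by norm_num) _).le
  have hL0 : 0 < 3200 * L := by linarith
  -- it suffices to treat the cost of an almost optimal coupling
  obtain ⟨c, hc, hcD⟩ : ∃ c, (∃ π : (Fin (2 ^ l) × Fin (2 ^ l)) → (Fin (2 ^ l) × Fin (2 ^ l)) → ℝ,
      (∀ p q, 0 ≤ π p q) ∧ (∀ p, ∑ q, π p q = μ p) ∧ (∀ q, ∑ p, π p q = ν q) ∧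
      c = ∑ p, ∑ q, π p q *
        (|((p.1.1 : ℕ) : ℝ) - ((q.1.1 : ℕ) : ℝ)| + |((p.2.1 : ℕ) : ℝ) - ((q.2.1 : ℕ) : ℝ)|)) ∧
      ∀ s : Fin (2 ^ l) × Fin (2 ^ l),
        gridEmbNorm l ((s.1 : ℤ), (s.2 : ℤ)) (fun p => μ p - ν p) ≤ 3200 * L * c →
        gridEmbNorm l ((s.1 : ℤ), (s.2 : ℤ)) (fun p => μ p - ν p) ≤ 3200 * L * D := by
    have hne : {c : ℝ | ∃ π : (Fin (2 ^ l) × Fin (2 ^ l)) → (Fin (2 ^ l) × Fin (2 ^ l)) → ℝ,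
        (∀ p q, 0 ≤ π p q) ∧ (∀ p, ∑ q, π p q = μ p) ∧ (∀ q, ∑ p, π p q = ν q) ∧
        c = ∑ p, ∑ q, π p q * (|((p.1.1 : ℕ) : ℝ) - ((q.1.1 : ℕ) : ℝ)| +
          |((p.2.1 : ℕ) : ℝ) - ((q.2.1 : ℕ) : ℝ)|)}.Nonempty :=
      ⟨_, fun p q => μ p * ν q, fun p q => mul_nonneg (hμ0 p) (hν0 q),
        fun p => by rw [← Finset.mul_sum, hν1, mul_one],
        fun q => by rw [← Finset.sum_mul, hμ1, one_mul], rfl⟩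
    set bad := Finset.univ.filter fun s : Fin (2 ^ l) × Fin (2 ^ l) =>
      3200 * L * D < gridEmbNorm l ((s.1 : ℤ), (s.2 : ℤ)) (fun p => μ p - ν p) with hbad
    rcases bad.eq_empty_or_nonempty with hb | hb
    · obtain ⟨c, hc⟩ := hne
      refine ⟨c, hc, fun s _ => not_lt.1 fun h => ?_⟩
      exact Finset.notMem_empty s (hb ▸ Finset.mem_filter.2 ⟨Finset.mem_univ s, h⟩)
    · obtain ⟨s₀, hs₀, hmin⟩ := bad.exists_min_image
        (fun s => gridEmbNorm l ((s.1 : ℤ), (s.2 : ℤ)) (fun p => μ p - ν p)) hb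
      have hlt : D < gridEmbNorm l ((s₀.1 : ℤ), (s₀.2 : ℤ)) (fun p => μ p - ν p) /
          (3200 * L) := by
        rw [lt_div_iff₀' hL0]
        exact (Finset.mem_filter.1 hs₀).2
      obtain ⟨c, hc, hcl⟩ := exists_lt_of_csInf_lt hne hlt
      refine ⟨c, hc, fun s hs => not_lt.1 fun h => ?_⟩
      rw [lt_div_iff₀' hL0] at hcl
      exact absurd (hmin s (Finset.mem_filter.2 ⟨Finset.mem_univ s, h⟩)) (not_le.2 (hs.trans_lt hcl))
  obtain ⟨π, h0, hμ, hν, rfl⟩ := hc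
  refine (card_gridEmbNorm_le_coupling hm800 hsupp h0 hμ hν).trans ?_
  refine Nat.cast_le.2 (Finset.card_le_card (Finset.monotone_filter_right _ fun s _ hs => ?_))
  refine hcD s (hs.trans ?_)
  simp_rw [cast_gridDist]
  have hc0 : 0 ≤ ∑ p, ∑ q, π p q * (|((p.1.1 : ℕ) : ℝ) - ((q.1.1 : ℕ) : ℝ)| +
      |((p.2.1 : ℕ) : ℝ) - ((q.2.1 : ℕ) : ℝ)|) :=
    Finset.sum_nonneg fun p _ => Finset.sum_nonneg fun q _ => mul_nonneg (h0 p q) (by positivity)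
  nlinarith [mul_le_mul_of_nonneg_right hmL hc0]
end

section
/- There exists a universal constant C > 0 with the following property. Let Δ = 2^l, let μ, ν : {0,…,Δ−1}² → ℝ≥0 each sum to 1, and suppose μ − ν = Σ_{i=1}^{p} w_i·(e_{x_i} − e_{y_i}) where w_i ≥ 0 and x_i, y_i ∈ {0,…,Δ−1}². Let B_j = B_{ℓ1}(u_j, R_j), j = 1,…,q, be ℓ₁-balls in the plane with 0 < R_j ≤ 2Δ, and let j* : {1,…,p} → {1,…,q} be such that x_i, y_i ∈ B_{j*(i)} for every i. Set w̃_j := Σ_{i : j*(i) = j} w_i, T := Σ_j w̃_j·R_j, and assume T > 0; let α_j := w̃_j·R_j / T. If s is chosen uniformly at random from {0,…,Δ−1}², then with probability at least 0.99, ‖G_s(μ − ν)‖₁ ≤ C·(1 + H(α))·T, where H(α) = Σ_j α_j·log₂(1/α_j). -/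
open scoped Classical

/-- Membership in the `ℓ₁`-ball `B_{ℓ₁}(u, R)` in the plane. -/
def inBall (u : ℝ × ℝ) (R : ℝ) (z : ℝ × ℝ) : Prop :=
  |z.1 - u.1| + |z.2 - u.2| ≤ R

/-- Some grid line `t ≡ s (mod 2^k)` separates two integers of the interval `[c - R, c + R]`. -/
def axisCut (c R : ℝ) (k : ℕ) (s : ℤ) : Prop :=
  ∃ t ∈ Finset.Ioc ⌈c - R⌉ ⌊c + R⌋, (2 : ℤ) ^ k ∣ t - s

/-- The bounding square of the ball `B_{ℓ₁}(u, R)` is cut by the grid `𝒢_{s,k}`. -/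
def ballCut (u : ℝ × ℝ) (R : ℝ) (k : ℕ) (s : ℤ × ℤ) : Prop :=
  axisCut u.1 R k s.1 ∨ axisCut u.2 R k s.2

lemma axisCut.mono {c R : ℝ} {k k' : ℕ} {s : ℤ} (hk : k ≤ k') (h : axisCut c R k' s) :
    axisCut c R k s := by
  obtain ⟨t, ht, hd⟩ := h
  exact ⟨t, ht, (pow_dvd_pow 2 hk).trans hd⟩

lemma ballCut.mono {u : ℝ × ℝ} {R : ℝ} {k k' : ℕ} {s : ℤ × ℤ} (hk : k ≤ k')
    (h : ballCut u R k' s) : ballCut u R k s :=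
  h.imp (axisCut.mono hk) (axisCut.mono hk)

lemma axisCut_of_floor_lt {c R : ℝ} {k : ℕ} {s a b : ℤ} (ha : |(a : ℝ) - c| ≤ R)
    (hb : |(b : ℝ) - c| ≤ R)
    (hab : ⌊((a : ℝ) - s) / 2 ^ k⌋ < ⌊((b : ℝ) - s) / 2 ^ k⌋) : axisCut c R k s := by
  have h2 : (0 : ℝ) < 2 ^ k := by positivity
  rw [abs_le] at ha hb
  refine ⟨s + 2 ^ k * ⌊((b : ℝ) - s) / 2 ^ k⌋, ?_, by simp⟩
  have hle := Int.floor_le (((b : ℝ) - s) / 2 ^ k)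
  rw [le_div_iff₀ h2] at hle
  have hlt := Int.floor_lt.1 hab
  rw [div_lt_iff₀ h2] at hlt
  rw [Finset.mem_Ioc]
  constructor
  · have : ((a : ℤ) : ℝ) < ((s + 2 ^ k * ⌊((b : ℝ) - s) / 2 ^ k⌋ : ℤ) : ℝ) := by
      push_cast; linarith
    exact lt_of_le_of_lt (Int.ceil_le.2 (by linarith)) (Int.cast_lt.1 this)
  · rw [Int.le_floor]
    push_cast; linarith

lemma axisCut_of_floor_ne {c R : ℝ} {k : ℕ} {s a b : ℤ} (ha : |(a : ℝ) - c| ≤ R)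
    (hb : |(b : ℝ) - c| ≤ R)
    (hab : ⌊((a : ℝ) - s) / 2 ^ k⌋ ≠ ⌊((b : ℝ) - s) / 2 ^ k⌋) : axisCut c R k s :=
  hab.lt_or_gt.elim (axisCut_of_floor_lt ha hb) (axisCut_of_floor_lt hb ha)

lemma ballCut_of_cellOf_ne {Δ : ℕ} {u : ℝ × ℝ} {R : ℝ} {k : ℕ} {s : ℤ × ℤ}
    {x y : Fin Δ × Fin Δ} (hx : inBall u R (toPlane x)) (hy : inBall u R (toPlane y))
    (hxy : cellOf s k (toPlane x) ≠ cellOf s k (toPlane y)) : ballCut u R k s := by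
  unfold inBall toPlane at hx hy
  simp only at hx hy
  have hx1 := abs_nonneg (((x.1 : ℕ) : ℝ) - u.1)
  have hx2 := abs_nonneg (((x.2 : ℕ) : ℝ) - u.2)
  have hy1 := abs_nonneg (((y.1 : ℕ) : ℝ) - u.1)
  have hy2 := abs_nonneg (((y.2 : ℕ) : ℝ) - u.2)
  by_cases h1 : ⌊(((x.1 : ℕ) : ℝ) - s.1) / 2 ^ k⌋ = ⌊(((y.1 : ℕ) : ℝ) - s.1) / 2 ^ k⌋
  · right
    refine axisCut_of_floor_ne (a := ((x.2 : ℕ) : ℤ)) (b := ((y.2 : ℕ) : ℤ)) ?_ ?_ ?_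
    · push_cast; linarith
    · push_cast; linarith
    · intro h2
      push_cast at h2
      exact hxy (Prod.ext h1 h2)
  · left
    refine axisCut_of_floor_ne (a := ((x.1 : ℕ) : ℤ)) (b := ((y.1 : ℕ) : ℤ)) ?_ ?_ ?_
    · push_cast; linarith
    · push_cast; linarith
    · push_cast
      exact h1

lemma card_filter_pow_two_dvd_sub {k l : ℕ} (hk : k ≤ l) (t : ℤ) :
    (Finset.univ.filter fun s : Fin (2 ^ l) => (2 : ℤ) ^ k ∣ t - ((s : ℕ) : ℤ)).card
      ≤ 2 ^ (l - k) := by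
  have h1 : (Finset.univ.filter fun s : Fin (2 ^ l) => (2 : ℤ) ^ k ∣ t - ((s : ℕ) : ℤ)).card
      ≤ ((Finset.Ico (0 : ℤ) (2 ^ l)).filter fun z => z ≡ t [ZMOD 2 ^ k]).card := by
    refine Finset.card_le_card_of_injOn (fun s => ((s : ℕ) : ℤ)) ?_ ?_
    · intro s hs
      simp only [Finset.coe_filter, Finset.mem_univ, true_and, Set.mem_ofPred_eq] at hs
      simp only [Finset.coe_filter, Finset.mem_Ico, Set.mem_ofPred_eq]
      exact ⟨⟨by positivity, by exact_mod_cast s.2⟩, Int.modEq_iff_dvd.2 hs⟩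
    · intro a _ b _ hab
      exact Fin.ext (by simpa using hab)
  have h2 := Int.Ico_filter_modEq_card (a := 0) (b := 2 ^ l) (r := 2 ^ k) (by positivity) t
  have h3 : (((2 ^ l : ℤ) - t : ℚ)) / ((2 ^ k : ℤ) : ℚ)
      = ((0 : ℤ) - t : ℚ) / ((2 ^ k : ℤ) : ℚ) + ((2 ^ (l - k) : ℤ) : ℚ) := by
    have : (2 : ℚ) ^ l = 2 ^ k * 2 ^ (l - k) := by rw [← pow_add]; congr 1; omega
    push_cast
    rw [this]
    field_simp
    ring
  rw [h3, Int.ceil_add_intCast] at h2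
  have h4 : (0 : ℤ) ≤ 2 ^ (l - k) := by positivity
  rw [add_sub_cancel_left, max_eq_left h4] at h2
  have : (((Finset.Ico (0 : ℤ) (2 ^ l)).filter fun z => z ≡ t [ZMOD 2 ^ k]).card : ℤ)
    = ((2 ^ (l - k) : ℕ) : ℤ) := by push_cast; exact h2
  exact h1.trans (Int.ofNat_inj.1 this).le

lemma card_filter_axisCut_le {k l : ℕ} (hk : k ≤ l) (c : ℝ) {R : ℝ} (hR : 0 ≤ R) :
    ((Finset.univ.filter fun s : Fin (2 ^ l) => axisCut c R k ((s : ℕ) : ℤ)).card : ℝ)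
      ≤ 2 * R * 2 ^ l / 2 ^ k := by
  have h1 : (Finset.univ.filter fun s : Fin (2 ^ l) => axisCut c R k ((s : ℕ) : ℤ))
      ⊆ (Finset.Ioc ⌈c - R⌉ ⌊c + R⌋).biUnion fun t =>
        Finset.univ.filter fun s : Fin (2 ^ l) => (2 : ℤ) ^ k ∣ t - ((s : ℕ) : ℤ) := by
    intro s hs
    simpa [axisCut] using hs
  have h2 := (Finset.card_le_card h1).trans
    (Finset.card_biUnion_le_card_mul _ _ (2 ^ (l - k))
      fun t _ => card_filter_pow_two_dvd_sub hk t)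
  have h3 : ((Finset.Ioc ⌈c - R⌉ ⌊c + R⌋).card : ℝ) ≤ 2 * R := by
    rw [Int.card_Ioc]
    have h := Int.floor_le (c + R)
    have h' := Int.le_ceil (c - R)
    rcases le_total 0 (⌊c + R⌋ - ⌈c - R⌉) with h0 | h0
    · have : (((⌊c + R⌋ - ⌈c - R⌉).toNat : ℤ) : ℝ) = ((⌊c + R⌋ - ⌈c - R⌉ : ℤ) : ℝ) := by
        rw [Int.toNat_of_nonneg h0]
      rw [Int.cast_natCast] at this
      rw [this]; push_cast; linarith
    · rw [Int.toNat_of_nonpos h0]; simp; linarith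
  have h4 : (2 : ℝ) ^ l / 2 ^ k = 2 ^ (l - k) := by
    rw [pow_sub₀ _ (by norm_num) hk]; rfl
  calc ((Finset.univ.filter fun s : Fin (2 ^ l) => axisCut c R k ((s : ℕ) : ℤ)).card : ℝ)
      ≤ (Finset.Ioc ⌈c - R⌉ ⌊c + R⌋).card * 2 ^ (l - k) := by exact_mod_cast h2
    _ ≤ 2 * R * 2 ^ (l - k) := by gcongr
    _ = 2 * R * 2 ^ l / 2 ^ k := by rw [mul_div_assoc, h4]

lemma card_filter_ballCut_le {k l : ℕ} (hk : k ≤ l) (u : ℝ × ℝ) {R : ℝ} (hR : 0 ≤ R) :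
    ((Finset.univ.filter fun s : Fin (2 ^ l) × Fin (2 ^ l) =>
      ballCut u R k ((s.1 : ℤ), (s.2 : ℤ))).card : ℝ) ≤ ((2 : ℝ) ^ l) ^ 2 * (4 * R / 2 ^ k) := by
  have h1 : (Finset.univ.filter fun s : Fin (2 ^ l) × Fin (2 ^ l) =>
      ballCut u R k ((s.1 : ℤ), (s.2 : ℤ))) ⊆
      (Finset.univ.filter fun s : Fin (2 ^ l) => axisCut u.1 R k ((s : ℕ) : ℤ)) ×ˢ Finset.univ ∪
      Finset.univ ×ˢ (Finset.univ.filter fun s : Fin (2 ^ l) => axisCut u.2 R k ((s : ℕ) : ℤ)) := by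
    intro s hs
    rw [Finset.mem_filter] at hs
    simpa [ballCut] using hs.2
  have h2 := (Finset.card_le_card h1).trans (Finset.card_union_le _ _)
  rw [Finset.card_product, Finset.card_product, Finset.card_univ, Fintype.card_fin] at h2
  have h3 := (Nat.cast_le (α := ℝ)).2 h2
  push_cast at h3
  have ha := card_filter_axisCut_le hk u.1 hR
  have hb := card_filter_axisCut_le hk u.2 hR
  have h0 : (0 : ℝ) ≤ 2 ^ l := by positivity
  calc _ ≤ _ := h3
    _ ≤ 2 * R * 2 ^ l / 2 ^ k * 2 ^ l + 2 ^ l * (2 * R * 2 ^ l / 2 ^ k) := by gcongr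
    _ = _ := by ring

lemma gridEmbNorm_le {l p : ℕ} (s : ℤ × ℤ) {f : Fin (2 ^ l) × Fin (2 ^ l) → ℝ} {w : Fin p → ℝ}
    {x y : Fin p → Fin (2 ^ l) × Fin (2 ^ l)} (hw : ∀ i, 0 ≤ w i)
    (hf : ∀ pt, f pt =
      ∑ i, w i * ((if x i = pt then (1 : ℝ) else 0) - (if y i = pt then (1 : ℝ) else 0))) :
    gridEmbNorm l s f ≤ ∑ k ∈ Finset.range (l + 1), (2 : ℝ) ^ k *
      ∑ i, w i * (if cellOf s k (toPlane (x i)) ≠ cellOf s k (toPlane (y i)) then 2 else 0) := by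
  unfold gridEmbNorm
  gcongr with k _
  have key : ∀ c : ℤ × ℤ, ∑ pt ∈ Finset.univ.filter (fun pt => cellOf s k (toPlane pt) = c), f pt
      = ∑ i, w i * ((if cellOf s k (toPlane (x i)) = c then (1 : ℝ) else 0)
        - (if cellOf s k (toPlane (y i)) = c then (1 : ℝ) else 0)) := by
    intro c
    simp_rw [hf]
    rw [Finset.sum_comm]
    refine Finset.sum_congr rfl fun i _ => ?_
    rw [← Finset.mul_sum, Finset.sum_sub_distrib, Finset.sum_ite_eq, Finset.sum_ite_eq]
    simp
  simp_rw [key]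
  calc _ ≤ ∑ c ∈ Finset.univ.image
          (fun p : Fin (2 ^ l) × Fin (2 ^ l) => cellOf s k (toPlane p)),
        ∑ i, w i * |(if cellOf s k (toPlane (x i)) = c then (1 : ℝ) else 0)
        - (if cellOf s k (toPlane (y i)) = c then (1 : ℝ) else 0)| := by
        refine Finset.sum_le_sum fun c _ => (Finset.abs_sum_le_sum_abs _ _).trans_eq ?_
        refine Finset.sum_congr rfl fun i _ => ?_
        rw [abs_mul, abs_of_nonneg (hw i)]
    _ ≤ _ := by
        rw [Finset.sum_comm]
        refine Finset.sum_le_sum fun i _ => ?_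
        rw [← Finset.mul_sum]
        refine mul_le_mul_of_nonneg_left ?_ (hw i)
        split_ifs with h
        · refine (Finset.sum_le_sum (g := fun c =>
            (if cellOf s k (toPlane (x i)) = c then (1 : ℝ) else 0)
              + (if cellOf s k (toPlane (y i)) = c then (1 : ℝ) else 0)) fun c _ => ?_).trans ?_
          · split_ifs <;> norm_num
          · rw [Finset.sum_add_distrib, Finset.sum_ite_eq, Finset.sum_ite_eq]
            split_ifs <;> norm_num
        · rw [not_not] at h
          simp [h]

lemma sum_two_pow_filter_lt_le {R : ℝ} (hR : 0 ≤ R) (n : ℕ) :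
    ∑ k ∈ (Finset.range n).filter (fun k => (2 : ℝ) ^ k < R), (2 : ℝ) ^ k ≤ 2 * R := by
  induction n with
  | zero => simpa using hR
  | succ n ih =>
    by_cases h : (2 : ℝ) ^ n < R
    · calc _ ≤ ∑ k ∈ Finset.range (n + 1), (2 : ℝ) ^ k :=
            Finset.sum_le_sum_of_subset_of_nonneg (Finset.filter_subset _ _)
              fun _ _ _ => by positivity
        _ ≤ 2 * R := by
            rw [geom_sum_eq (by norm_num), pow_succ]
            norm_num
            linarith
    · rwa [Finset.range_add_one, Finset.filter_insert, if_neg h]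

lemma card_filter_two_pow_le {R M : ℝ} (hR : 0 < R) (hM : 1 ≤ M) (n : ℕ) :
    (((Finset.range n).filter fun k => R ≤ (2 : ℝ) ^ k ∧ (2 : ℝ) ^ k < M * R).card : ℝ)
      ≤ Real.logb 2 M + 1 := by
  have hlog : 0 ≤ Real.logb 2 M := Real.logb_nonneg (by norm_num) hM
  set S := (Finset.range n).filter fun k => R ≤ (2 : ℝ) ^ k ∧ (2 : ℝ) ^ k < M * R
  rcases S.eq_empty_or_nonempty with h | h
  · rw [h]; simp; linarith
  · set m := S.min' h with hm
    have hmS : m ∈ S := S.min'_mem h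
    have hsub : S ⊆ Finset.Icc m (m + ⌊Real.logb 2 M⌋₊) := by
      intro k hk
      have hmk : m ≤ k := S.min'_le k hk
      rw [Finset.mem_Icc]
      refine ⟨hmk, ?_⟩
      have h1 : R ≤ (2 : ℝ) ^ m := (Finset.mem_filter.1 hmS).2.1
      have h2 : (2 : ℝ) ^ k < M * R := (Finset.mem_filter.1 hk).2.2
      have h3 : (2 : ℝ) ^ (k - m) ≤ M := by
        have h4 : (2 : ℝ) ^ k = 2 ^ (k - m) * 2 ^ m := by
          rw [← pow_add]; congr 1; omega
        have h5 : (2 : ℝ) ^ (k - m) * R ≤ M * R := by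
          refine le_trans ?_ h2.le
          rw [h4]; gcongr
        exact le_of_mul_le_mul_right h5 hR
      have h6 : ((k - m : ℕ) : ℝ) ≤ Real.logb 2 M := by
        rw [Real.le_logb_iff_rpow_le (by norm_num) (by linarith), Real.rpow_natCast]
        exact h3
      have := Nat.le_floor h6
      omega
    have hc := Finset.card_le_card hsub
    rw [Nat.card_Icc] at hc
    have hc' : S.card ≤ ⌊Real.logb 2 M⌋₊ + 1 := by omega
    calc (S.card : ℝ) ≤ ((⌊Real.logb 2 M⌋₊ + 1 : ℕ) : ℝ) := Nat.cast_le.2 hc'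
      _ ≤ _ := by push_cast; linarith [Nat.floor_le hlog]

lemma sum_filter_two_pow_mul_le {R M N : ℝ} (hR : 0 < R) (hM : 1 ≤ M) (hN : 0 ≤ N) (n : ℕ)
    {c : ℕ → ℝ} (hcN : ∀ k, c k ≤ N) (hc : ∀ k < n, c k ≤ N * (4 * R / 2 ^ k)) :
    ∑ k ∈ (Finset.range n).filter (fun k => (2 : ℝ) ^ k < M * R), (2 : ℝ) ^ k * (2 * c k)
      ≤ N * R * (12 + 8 * Real.logb 2 M) := by
  rw [← Finset.sum_filter_add_sum_filter_not _ (fun k => (2 : ℝ) ^ k < R)]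
  have h1 : ∑ k ∈ ((Finset.range n).filter (fun k => (2 : ℝ) ^ k < M * R)).filter
      (fun k => (2 : ℝ) ^ k < R), (2 : ℝ) ^ k * (2 * c k) ≤ 2 * N * (2 * R) := by
    refine le_trans ?_ (mul_le_mul_of_nonneg_left (sum_two_pow_filter_lt_le hR.le n)
      (by positivity : 0 ≤ 2 * N))
    rw [Finset.mul_sum]
    calc _ ≤ ∑ k ∈ ((Finset.range n).filter (fun k => (2 : ℝ) ^ k < M * R)).filter
            (fun k => (2 : ℝ) ^ k < R), 2 * N * (2 : ℝ) ^ k := by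
          refine Finset.sum_le_sum fun k _ => ?_
          have h2 : (0 : ℝ) < 2 ^ k := by positivity
          nlinarith [hcN k]
      _ ≤ _ := by
          refine Finset.sum_le_sum_of_subset_of_nonneg ?_ fun _ _ _ => by positivity
          exact Finset.filter_subset_filter _ (Finset.filter_subset _ _)
  have h2 : ∑ k ∈ ((Finset.range n).filter (fun k => (2 : ℝ) ^ k < M * R)).filter
      (fun k => ¬ (2 : ℝ) ^ k < R), (2 : ℝ) ^ k * (2 * c k)
      ≤ (Real.logb 2 M + 1) * (8 * N * R) := by
    refine le_trans (Finset.sum_le_card_nsmul _ _ (8 * N * R) fun k hk => ?_) ?_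
    · have hk' := hc k (by simp at hk; exact hk.1.1)
      have h2 : (0 : ℝ) < 2 ^ k := by positivity
      calc (2 : ℝ) ^ k * (2 * c k) ≤ 2 ^ k * (2 * (N * (4 * R / 2 ^ k))) := by gcongr
        _ = 8 * N * R := by field_simp; ring
    · rw [nsmul_eq_mul]
      refine mul_le_mul_of_nonneg_right ?_ (by positivity)
      refine le_trans (le_of_eq ?_) (card_filter_two_pow_le hR hM n)
      congr 2
      ext k
      simp only [Finset.mem_filter, not_lt]
      tauto
  linarith

lemma card_filter_exists_le {S : Type*} [Fintype S] {R M N : ℝ} (hR : 0 < R) (hM : 0 < M)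
    (hN : 0 ≤ N) (n : ℕ) {f : ℕ → S → Prop} (hf : ∀ k k' s, k ≤ k' → f k' s → f k s)
    (hc : ∀ k < n, ((Finset.univ.filter (f k)).card : ℝ) ≤ N * (4 * R / 2 ^ k)) :
    ((Finset.univ.filter fun s => ∃ k < n, M * R ≤ (2 : ℝ) ^ k ∧ f k s).card : ℝ)
      ≤ N * (4 / M) := by
  by_cases h : ∃ k, k < n ∧ M * R ≤ (2 : ℝ) ^ k
  · obtain ⟨hK, hKR⟩ := Nat.find_spec h
    have hsub : (Finset.univ.filter fun s => ∃ k < n, M * R ≤ (2 : ℝ) ^ k ∧ f k s)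
        ⊆ Finset.univ.filter (f (Nat.find h)) := by
      intro s hs
      obtain ⟨k, hk, hkR, hks⟩ := (Finset.mem_filter.1 hs).2
      exact Finset.mem_filter.2
        ⟨Finset.mem_univ _, hf _ _ _ (Nat.find_min' h ⟨hk, hkR⟩) hks⟩
    calc _ ≤ ((Finset.univ.filter (f (Nat.find h))).card : ℝ) :=
          Nat.cast_le.2 (Finset.card_le_card hsub)
      _ ≤ N * (4 * R / 2 ^ (Nat.find h)) := hc _ hK
      _ ≤ N * (4 * R / (M * R)) := by gcongr
      _ = N * (4 / M) := by field_simp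
  · have h0 : (Finset.univ.filter fun s => ∃ k < n, M * R ≤ (2 : ℝ) ^ k ∧ f k s) = ∅ := by
      refine Finset.filter_eq_empty_iff.2 fun s _ => ?_
      rintro ⟨k, hk, hkR, _⟩
      exact h ⟨k, hk, hkR⟩
    rw [h0]
    simp only [Finset.card_empty, Nat.cast_zero]
    positivity

lemma logb_two_eight_hundred_le : Real.logb 2 800 ≤ 10 := by
  rw [Real.logb_le_iff_le_rpow (by norm_num) (by norm_num)]
  norm_num

/-- Multiscale Markov bound: if the `j`-th object is cut at scale `k` with probability at most
`4 R_j / 2^k`, and cuts are nested, then with probability `0.99` the total cut cost is at most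
the entropy-weighted cost. -/
lemma card_filter_cost_le_entropy {S : Type*} [Fintype S] {q : ℕ} (n : ℕ)
    {wt R : Fin q → ℝ} {f : Fin q → ℕ → S → Prop} (hwt : ∀ j, 0 ≤ wt j) (hR : ∀ j, 0 < R j)
    (hf : ∀ j k k' s, k ≤ k' → f j k' s → f j k s)
    (hc : ∀ j, ∀ k < n, ((Finset.univ.filter (f j k)).card : ℝ)
      ≤ Fintype.card S * (4 * R j / 2 ^ k))
    {T H : ℝ} (hT : T = ∑ j, wt j * R j) (hT0 : 0 < T)
    (hH : H = ∑ j, (wt j * R j / T) * Real.logb 2 (wt j * R j / T)⁻¹) :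
    0.99 * (Fintype.card S : ℝ) ≤ ((Finset.univ.filter fun s =>
      ∑ k ∈ Finset.range n, (2 : ℝ) ^ k * ∑ j, wt j * (if f j k s then 2 else 0)
        ≤ 18400 * (1 + H) * T).card : ℝ) := by
  set N : ℝ := ((Fintype.card S : ℕ) : ℝ) with hN
  have hN0 : 0 ≤ N := Nat.cast_nonneg _
  set α : Fin q → ℝ := fun j => wt j * R j / T with hα
  have hα0 : ∀ j, 0 ≤ α j := fun j => div_nonneg (mul_nonneg (hwt j) (hR j).le) hT0.le
  have hαsum : ∑ j, α j = 1 := by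
    rw [hα, ← Finset.sum_div, ← hT, div_self hT0.ne']
  have hα1 : ∀ j, α j ≤ 1 := fun j =>
    hαsum ▸ Finset.single_le_sum (fun i _ => hα0 i) (Finset.mem_univ j)
  have hαT : ∀ j, wt j * R j = α j * T := fun j => by
    simp only [hα]; field_simp
  have hH0 : 0 ≤ H := by
    rw [hH]
    refine Finset.sum_nonneg fun j _ => ?_
    rcases (hα0 j).eq_or_lt with h | h
    · change 0 ≤ α j * _
      rw [← h, zero_mul]
    · exact mul_nonneg (hα0 j) (Real.logb_nonneg (by norm_num) ((one_le_inv₀ h).2 (hα1 j)))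
  set P : Finset (Fin q) := Finset.univ.filter fun j => 0 < α j with hP
  have hwt0 : ∀ j, j ∉ P → wt j = 0 := by
    intro j hj
    have h0 : α j = 0 := le_antisymm (by simpa [hP] using hj) (hα0 j)
    have := hαT j
    rw [h0, zero_mul] at this
    exact (mul_eq_zero.1 this).resolve_right (hR j).ne'
  set M : Fin q → ℝ := fun j => 800 / α j with hM
  have hMpos : ∀ j ∈ P, 0 < M j := fun j hj =>
    div_pos (by norm_num) (Finset.mem_filter.1 hj).2
  have hM1 : ∀ j ∈ P, 1 ≤ M j := fun j hj => by
    rw [hM, one_le_div (Finset.mem_filter.1 hj).2]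
    linarith [hα1 j]
  -- the truncated cost
  set Z : S → ℝ := fun s => ∑ j ∈ P, wt j *
    ∑ k ∈ (Finset.range n).filter (fun k => (2 : ℝ) ^ k < M j * R j),
      (2 : ℝ) ^ k * (if f j k s then 2 else 0) with hZ
  have hZ0 : ∀ s, 0 ≤ Z s := fun s => Finset.sum_nonneg fun j _ =>
    mul_nonneg (hwt j) (Finset.sum_nonneg fun k _ => by split_ifs <;> positivity)
  have hZsum : ∑ s, Z s ≤ N * (92 * (1 + H) * T) := by
    calc ∑ s, Z s = ∑ j ∈ P, wt j *
          ∑ k ∈ (Finset.range n).filter (fun k => (2 : ℝ) ^ k < M j * R j),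
            (2 : ℝ) ^ k * (2 * ((Finset.univ.filter (f j k)).card : ℝ)) := by
          simp only [hZ]
          rw [Finset.sum_comm]
          refine Finset.sum_congr rfl fun j _ => ?_
          rw [← Finset.mul_sum, Finset.sum_comm]
          congr 1
          refine Finset.sum_congr rfl fun k _ => ?_
          rw [← Finset.mul_sum, ← Finset.sum_filter, Finset.sum_const, nsmul_eq_mul, mul_comm 2]
      _ ≤ ∑ j ∈ P, wt j * (N * R j * (12 + 8 * Real.logb 2 (M j))) := by
          refine Finset.sum_le_sum fun j hj => mul_le_mul_of_nonneg_left ?_ (hwt j)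
          refine sum_filter_two_pow_mul_le (hR j) (hM1 j hj) hN0 n (fun k => ?_) (hc j)
          exact Nat.cast_le.2 (Finset.card_le_univ _)
      _ ≤ ∑ j ∈ P, N * T * (92 * α j + 8 * (α j * Real.logb 2 (α j)⁻¹)) := by
          refine Finset.sum_le_sum fun j hj => ?_
          have hj0 : 0 < α j := (Finset.mem_filter.1 hj).2
          have hlog : Real.logb 2 (M j) ≤ 10 + Real.logb 2 (α j)⁻¹ := by
            simp only [hM]
            rw [div_eq_mul_inv, Real.logb_mul (by norm_num) (inv_pos.2 hj0).ne']
            linarith [logb_two_eight_hundred_le]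
          calc wt j * (N * R j * (12 + 8 * Real.logb 2 (M j)))
              = N * (wt j * R j) * (12 + 8 * Real.logb 2 (M j)) := by ring
            _ ≤ N * (wt j * R j) * (12 + 8 * (10 + Real.logb 2 (α j)⁻¹)) := by
                have := mul_nonneg (hwt j) (hR j).le
                gcongr
            _ = _ := by rw [hαT j]; ring
      _ ≤ ∑ j, N * T * (92 * α j + 8 * (α j * Real.logb 2 (α j)⁻¹)) := by
          refine Finset.sum_le_sum_of_subset_of_nonneg (Finset.subset_univ _) fun j _ hj => ?_
          have h0 : α j = 0 := le_antisymm (by simpa [hP] using hj) (hα0 j)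
          simp [h0]
      _ = N * T * (92 + 8 * H) := by
          rw [← Finset.mul_sum, Finset.sum_add_distrib, ← Finset.mul_sum, ← Finset.mul_sum,
            hαsum, hH, mul_one]
      _ ≤ N * (92 * (1 + H) * T) := by
          have := mul_nonneg (mul_nonneg hN0 hT0.le) hH0
          linarith
  set good := Finset.univ.filter fun s =>
      ∑ k ∈ Finset.range n, (2 : ℝ) ^ k * ∑ j, wt j * (if f j k s then 2 else 0)
        ≤ 18400 * (1 + H) * T with hgood
  set bad := P.biUnion fun j =>
    Finset.univ.filter fun s => ∃ k < n, M j * R j ≤ (2 : ℝ) ^ k ∧ f j k s with hbad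
  set large := Finset.univ.filter fun s => 18400 * (1 + H) * T < Z s with hlarge
  have hbadcard : (bad.card : ℝ) ≤ N * 0.005 := by
    calc (bad.card : ℝ) ≤ ∑ j ∈ P, ((Finset.univ.filter fun s =>
            ∃ k < n, M j * R j ≤ (2 : ℝ) ^ k ∧ f j k s).card : ℝ) := by
          rw [← Nat.cast_sum]
          exact Nat.cast_le.2 Finset.card_biUnion_le
      _ ≤ ∑ j ∈ P, N * (4 / M j) := Finset.sum_le_sum fun j hj =>
          card_filter_exists_le (hR j) (hMpos j hj) hN0 n (hf j) (hc j)
      _ = ∑ j ∈ P, N * 0.005 * α j := by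
          refine Finset.sum_congr rfl fun j _ => ?_
          simp only [hM]
          rw [div_div_eq_mul_div]; ring
      _ ≤ ∑ j, N * 0.005 * α j :=
          Finset.sum_le_sum_of_subset_of_nonneg (Finset.subset_univ _) fun j _ _ =>
            mul_nonneg (by positivity) (hα0 j)
      _ = N * 0.005 := by rw [← Finset.mul_sum, hαsum, mul_one]
  have hlargecard : (large.card : ℝ) ≤ N * 0.005 := by
    have h1 : (large.card : ℝ) * (18400 * (1 + H) * T) ≤ ∑ s, Z s := by
      rw [← nsmul_eq_mul]
      refine (Finset.card_nsmul_le_sum large Z _ fun s hs => (Finset.mem_filter.1 hs).2.le).trans ?_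
      exact Finset.sum_le_sum_of_subset_of_nonneg (Finset.subset_univ _) fun s _ _ => hZ0 s
    have h2 : 0 < (1 + H) * T := by positivity
    have h3 := h1.trans hZsum
    refine le_of_mul_le_mul_right (a := 18400 * ((1 + H) * T)) ?_ (by positivity)
    linarith
  have hcover : Finset.univ ⊆ good ∪ (bad ∪ large) := by
    intro s _
    by_contra hs
    simp only [Finset.mem_union, not_or] at hs
    obtain ⟨hsg, hsb, hsl⟩ := hs
    refine hsg (Finset.mem_filter.2 ⟨Finset.mem_univ _, ?_⟩)
    have hZs : Z s ≤ 18400 * (1 + H) * T := by simpa [hlarge] using hsl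
    refine le_trans (le_of_eq ?_) hZs
    simp only [hZ, Finset.mul_sum]
    rw [Finset.sum_comm]
    symm
    refine (Finset.sum_congr rfl fun j hj => ?_).trans
      (Finset.sum_subset (Finset.subset_univ P) fun j _ hj => ?_)
    · rw [Finset.sum_filter]
      refine Finset.sum_congr rfl fun k hk => ?_
      by_cases hkM : (2 : ℝ) ^ k < M j * R j
      · rw [if_pos hkM]; ring
      · have hfk : ¬ f j k s := fun hfk => hsb (Finset.mem_biUnion.2 ⟨j, hj,
          Finset.mem_filter.2 ⟨Finset.mem_univ _, k, Finset.mem_range.1 hk, not_lt.1 hkM, hfk⟩⟩)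
        rw [if_neg hkM, if_neg hfk]; ring
    · simp [hwt0 j hj]
  have hcard : N ≤ good.card + (bad.card + large.card) := by
    have h1 := (Finset.card_le_card hcover).trans (Finset.card_union_le _ _)
    have h2 := h1.trans (Nat.add_le_add_left (Finset.card_union_le bad large) _)
    rw [Finset.card_univ] at h2
    rw [hN]
    exact_mod_cast h2
  linarith

/-- Claim `balls_ent`: if the transportation `μ − ν = Σ wᵢ (e_{xᵢ} − e_{yᵢ})` has each edge
enclosed in one of the `ℓ₁`-balls `B_j = B(u_j, R_j)` (via the allocation `j*`), then for a
uniformly random shift `s`, with probability at least `0.99`,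
`‖G_s(μ − ν)‖₁ ≤ O(1) (1 + H(α)) T`, where `w̃_j = Σ_{i : j*(i)=j} wᵢ`, `T = Σ_j w̃_j R_j`
and `α_j = w̃_j R_j / T`. -/
theorem stmt_10 : ∃ C : ℝ, 0 < C ∧
    ∀ (l p q : ℕ) (μ ν : Fin (2 ^ l) × Fin (2 ^ l) → ℝ)
      (w : Fin p → ℝ) (x y : Fin p → Fin (2 ^ l) × Fin (2 ^ l))
      (u : Fin q → ℝ × ℝ) (R : Fin q → ℝ) (jstar : Fin p → Fin q),
      (∀ pt, 0 ≤ μ pt) → (∀ pt, 0 ≤ ν pt) →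
      (∑ pt, μ pt = 1) → (∑ pt, ν pt = 1) →
      (∀ i, 0 ≤ w i) →
      (∀ pt, μ pt - ν pt =
        ∑ i, w i * ((if x i = pt then (1 : ℝ) else 0) - (if y i = pt then (1 : ℝ) else 0))) →
      (∀ j, 0 < R j) → (∀ j, R j ≤ 2 * 2 ^ l) →
      (∀ i, inBall (u (jstar i)) (R (jstar i)) (toPlane (x i)) ∧
            inBall (u (jstar i)) (R (jstar i)) (toPlane (y i))) →
      ∀ wt : Fin q → ℝ,
        (∀ j, wt j = ∑ i ∈ Finset.univ.filter fun i => jstar i = j, w i) →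
      ∀ T : ℝ, T = ∑ j, wt j * R j → 0 < T →
      ∀ H : ℝ, H = ∑ j, (wt j * R j / T) * Real.logb 2 (wt j * R j / T)⁻¹ →
      (0.99 : ℝ) ≤
        ((Finset.univ.filter fun s : Fin (2 ^ l) × Fin (2 ^ l) =>
            gridEmbNorm l ((s.1 : ℤ), (s.2 : ℤ)) (fun pt => μ pt - ν pt) ≤
              C * (1 + H) * T).card : ℝ) / ((2 : ℝ) ^ l) ^ 2 := by
  refine ⟨18400, by norm_num, ?_⟩
  intro l p q μ ν w x y u R jstar _ _ _ _ hw hμν hR _ hball wt hwt T hT hT0 H hH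
  have hwt0 : ∀ j, 0 ≤ wt j := fun j => by
    rw [hwt j]; exact Finset.sum_nonneg fun i _ => hw i
  have hcardS : (Fintype.card (Fin (2 ^ l) × Fin (2 ^ l)) : ℝ) = ((2 : ℝ) ^ l) ^ 2 := by
    rw [Fintype.card_prod, Fintype.card_fin]; push_cast; ring
  have hmain := card_filter_cost_le_entropy (S := Fin (2 ^ l) × Fin (2 ^ l)) (l + 1)
    (f := fun j k s => ballCut (u j) (R j) k ((s.1 : ℤ), (s.2 : ℤ))) hwt0 hR
    (fun j k k' s hk h => h.mono hk)
    (fun j k hk => by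
      rw [hcardS]
      exact card_filter_ballCut_le (Nat.lt_succ_iff.1 hk) (u j) (hR j).le) hT hT0 hH
  rw [hcardS] at hmain
  rw [le_div_iff₀ (by positivity)]
  refine hmain.trans (Nat.cast_le.2 (Finset.card_le_card fun s hs => ?_))
  refine Finset.mem_filter.2 ⟨Finset.mem_univ _, le_trans ?_ (Finset.mem_filter.1 hs).2⟩
  refine (gridEmbNorm_le _ hw hμν).trans ?_
  refine Finset.sum_le_sum fun k _ => mul_le_mul_of_nonneg_left ?_ (by positivity)
  rw [← Finset.sum_fiberwise Finset.univ jstar]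
  refine Finset.sum_le_sum fun j _ => ?_
  rw [hwt j, Finset.sum_mul]
  refine Finset.sum_le_sum fun i hi => mul_le_mul_of_nonneg_left ?_ (hw i)
  obtain rfl := (Finset.mem_filter.1 hi).2
  by_cases h : cellOf ((s.1 : ℤ), (s.2 : ℤ)) k (toPlane (x i))
      = cellOf ((s.1 : ℤ), (s.2 : ℤ)) k (toPlane (y i))
  · rw [if_neg (not_not.2 h)]
    split_ifs <;> norm_num
  · rw [if_pos h, if_pos (ballCut_of_cellOf_ne (hball i).1 (hball i).2 h)]
end

section
/- There exists a universal constant C > 0 with the following property. Let n ≥ d ≥ 1 be integers, ε, δ ∈ (0, 1), and let m be an integer with m ≥ C·(d/ε²)·log(d/(ε·δ)). Let L be a d-dimensional linear subspace of ℝⁿ, and let A be a random m × n matrix whose entries are i.i.d. standard Cauchy random variables. Then with probability at least 1 − δ, simultaneously for all x ∈ L: (1 − ε)·‖x‖₁ ≤ ‖A·x‖_med ≤ (1 + ε)·‖x‖₁. -/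
open scoped Classical
open MeasureTheory

/-- The standard Cauchy distribution on ℝ, with density `1/(π(1 + t²))`. -/
noncomputable def cauchyMeasure : Measure ℝ :=
  volume.withDensity fun t => ENNReal.ofReal (1 / (Real.pi * (1 + t ^ 2)))

/-- `‖v‖_med`: the `⌈m/2⌉`-th smallest value among `|v₁|, …, |v_m|`
(the median of the absolute values). -/
noncomputable def medNorm {m : ℕ} (v : Fin m → ℝ) : ℝ :=
  sInf {t : ℝ | (m + 1) / 2 ≤ (Finset.univ.filter fun i => |v i| ≤ t).card}

lemma cauchyMeasure_eq : cauchyMeasure = ProbabilityTheory.cauchyMeasure 0 1 := by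
  rw [ProbabilityTheory.cauchyMeasure_of_scale_ne_zero 0 one_ne_zero, cauchyMeasure]
  congr 1
  ext t
  rw [ProbabilityTheory.cauchyPDF_def, ProbabilityTheory.cauchyPDFReal_def]
  congr 1
  simp [mul_comm, add_comm]

instance isProbabilityMeasure_cauchyMeasure : IsProbabilityMeasure cauchyMeasure := by
  rw [cauchyMeasure_eq]
  infer_instance

lemma integral_cauchyMeasure {E : Type*} [NormedAddCommGroup E] [NormedSpace ℝ E] (g : ℝ → E) :
    ∫ x, g x ∂cauchyMeasure = ∫ x, (1 / (Real.pi * (1 + x ^ 2))) • g x := by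
  rw [cauchyMeasure, integral_withDensity_eq_integral_toReal_smul (by fun_prop)
    (Filter.Eventually.of_forall fun x => ENNReal.ofReal_lt_top)]
  congr 1
  ext x
  rw [ENNReal.toReal_ofReal (by positivity)]

lemma cauchyMeasure_real_Icc {a : ℝ} (ha : 0 ≤ a) :
    cauchyMeasure.real (Set.Icc (-a) a) = 2 / Real.pi * Real.arctan a := by
  rw [← integral_indicator_one measurableSet_Icc, integral_cauchyMeasure]
  have h : (fun x : ℝ => (1 / (Real.pi * (1 + x ^ 2))) • (Set.Icc (-a) a).indicator 1 x) =
      (Set.Icc (-a) a).indicator (fun x : ℝ => (1 / Real.pi) * (1 + x ^ 2)⁻¹) := by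
    ext x
    by_cases hx : x ∈ Set.Icc (-a) a
    · simp [hx, mul_comm]
    · simp [hx]
  rw [h, integral_indicator measurableSet_Icc, integral_Icc_eq_integral_Ioc,
    ← intervalIntegral.integral_of_le (by linarith), intervalIntegral.integral_const_mul,
    integral_inv_one_add_sq, Real.arctan_neg]
  ring

lemma integrableOn_exp_neg_abs_aux (t : ℝ) :
    IntegrableOn (fun x : ℝ => Complex.exp (((1 : ℂ) + t * Complex.I) * x)) (Set.Iic 0) ∧
    IntegrableOn (fun x : ℝ => Complex.exp ((-(1 : ℂ) + t * Complex.I) * x)) (Set.Ioi 0) :=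
  ⟨integrableOn_exp_mul_complex_Iic (by simp) 0, integrableOn_exp_mul_complex_Ioi (by simp) 0⟩

lemma exp_mul_exp_neg_abs_eqOn (t : ℝ) :
    Set.EqOn (fun x : ℝ => Complex.exp (t * x * Complex.I) * Real.exp (-|x|))
      (fun x : ℝ => Complex.exp (((1 : ℂ) + t * Complex.I) * x)) (Set.Iic 0) ∧
    Set.EqOn (fun x : ℝ => Complex.exp (t * x * Complex.I) * Real.exp (-|x|))
      (fun x : ℝ => Complex.exp ((-(1 : ℂ) + t * Complex.I) * x)) (Set.Ioi 0) := by
  constructor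
  · intro x hx
    simp only [abs_of_nonpos (Set.mem_Iic.1 hx), Complex.ofReal_exp, ← Complex.exp_add]
    congr 1
    push_cast
    ring
  · intro x hx
    simp only [abs_of_pos (Set.mem_Ioi.1 hx), Complex.ofReal_exp, ← Complex.exp_add]
    congr 1
    push_cast
    ring

lemma integrable_exp_mul_exp_neg_abs (t : ℝ) :
    Integrable (fun x : ℝ => Complex.exp (t * x * Complex.I) * Real.exp (-|x|)) := by
  rw [← integrableOn_univ, ← Set.Iic_union_Ioi (a := (0 : ℝ)), integrableOn_union,
    integrableOn_congr_fun (exp_mul_exp_neg_abs_eqOn t).1 measurableSet_Iic,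
    integrableOn_congr_fun (exp_mul_exp_neg_abs_eqOn t).2 measurableSet_Ioi]
  exact integrableOn_exp_neg_abs_aux t

lemma integral_exp_mul_exp_neg_abs (t : ℝ) :
    ∫ x : ℝ, Complex.exp (t * x * Complex.I) * Real.exp (-|x|) = ((2 / (1 + t ^ 2) : ℝ) : ℂ) := by
  have h := integrable_exp_mul_exp_neg_abs t
  rw [← intervalIntegral.integral_Iic_add_Ioi (b := 0) h.integrableOn h.integrableOn,
    setIntegral_congr_fun measurableSet_Iic (exp_mul_exp_neg_abs_eqOn t).1,
    setIntegral_congr_fun measurableSet_Ioi (exp_mul_exp_neg_abs_eqOn t).2,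
    integral_exp_mul_complex_Iic (by simp) 0, integral_exp_mul_complex_Ioi (by simp) 0]
  have h1 : (1 : ℂ) + t * Complex.I ≠ 0 := fun h => by simpa using congrArg Complex.re h
  have h2 : -(1 : ℂ) + t * Complex.I ≠ 0 := fun h => by simpa using congrArg Complex.re h
  have h3 : (1 : ℂ) + t ^ 2 ≠ 0 := by
    have : (1 + t ^ 2 : ℝ) ≠ 0 := by positivity
    exact_mod_cast this
  push_cast
  simp only [mul_zero, Complex.exp_zero]
  field_simp
  ring_nf
  simp only [Complex.I_sq]
  ring

open scoped FourierTransform in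
lemma charFun_cauchyMeasure (t : ℝ) :
    charFun cauchyMeasure t = ((Real.exp (-|t|) : ℝ) : ℂ) := by
  set f : ℝ → ℂ := fun x => ((Real.exp (-|x|) : ℝ) : ℂ) with hf
  have hcont : Continuous f := by fun_prop
  have h_int : Integrable f := by simpa [hf] using integrable_exp_mul_exp_neg_abs 0
  have hF : 𝓕 f = fun w : ℝ => ((2 / (1 + (2 * Real.pi * w) ^ 2) : ℝ) : ℂ) := by
    ext w
    rw [Real.fourier_real_eq_integral_exp_smul]
    have := integral_exp_mul_exp_neg_abs (-2 * Real.pi * w)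
    rw [show (-2 * Real.pi * w) ^ 2 = (2 * Real.pi * w) ^ 2 by ring] at this
    rw [← this]
    congr 1
    ext v
    simp only [smul_eq_mul, hf]
    congr 2
    push_cast
    ring
  have hFint : Integrable (𝓕 f) := by
    rw [hF]
    have := (integrable_inv_one_add_sq.comp_mul_left' (R := 2 * Real.pi)
      (by positivity)).const_mul 2
    exact this.ofReal
  have hinv := congrFun (hcont.fourierInv_fourier_eq h_int hFint) t
  change _ = f t
  rw [← hinv, Real.fourierInv_eq', charFun_apply_real, integral_cauchyMeasure, hF]
  have := Measure.integral_comp_mul_left (fun x : ℝ =>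
    (1 / (Real.pi * (1 + x ^ 2))) • Complex.exp (t * x * Complex.I)) (2 * Real.pi)
  rw [inv_eq_one_div, abs_of_pos (by positivity), eq_comm, ← eq_inv_smul_iff₀ (by positivity),
    ← integral_smul] at this
  rw [this]
  congr 1
  ext x
  simp only [smul_eq_mul, Complex.real_smul, RCLike.inner_apply, conj_trivial]
  have hpi : (Real.pi : ℂ) ≠ 0 := by exact_mod_cast Real.pi_ne_zero
  rw [mul_comm (Complex.exp _), ← mul_assoc]
  congr 1
  · push_cast
    field_simp
  · push_cast
    ring_nf

/-- A linear combination of independent standard Cauchy variables is Cauchy, with scale the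
`ℓ₁` norm of the coefficients. -/
lemma map_sum_mul_pi_cauchyMeasure {n : ℕ} (x : Fin n → ℝ) :
    (Measure.pi fun _ : Fin n => cauchyMeasure).map (fun a => ∑ j, a j * x j) =
      cauchyMeasure.map (fun s => (∑ j, |x j|) * s) := by
  have hm : Measurable fun a : Fin n → ℝ => ∑ j, a j * x j := by fun_prop
  have hm' : Measurable fun s : ℝ => (∑ j, |x j|) * s := by fun_prop
  have := Measure.isProbabilityMeasure_map (μ := Measure.pi fun _ : Fin n => cauchyMeasure)
    hm.aemeasurable
  have := Measure.isProbabilityMeasure_map (μ := cauchyMeasure) hm'.aemeasurable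
  apply Measure.ext_of_charFun
  ext t
  rw [charFun_map_mul, charFun_cauchyMeasure, charFun_apply_real,
    integral_map hm.aemeasurable (by fun_prop)]
  have h : ∀ a : Fin n → ℝ, Complex.exp (t * ((∑ j, a j * x j : ℝ) : ℂ) * Complex.I) =
      ∏ j, Complex.exp (((x j * t : ℝ) : ℂ) * a j * Complex.I) := by
    intro a
    rw [← Complex.exp_sum]
    congr 1
    push_cast
    rw [Finset.mul_sum, Finset.sum_mul]
    refine Finset.sum_congr rfl fun j _ => by ring
  simp_rw [h]
  rw [integral_fintype_prod_eq_prod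
    (fun j (s : ℝ) => Complex.exp (((x j * t : ℝ) : ℂ) * s * Complex.I))]
  simp_rw [← charFun_apply_real, charFun_cauchyMeasure, ← Complex.ofReal_prod, ← Real.exp_sum]
  congr 2
  rw [abs_mul, abs_of_nonneg (Finset.sum_nonneg fun j _ => abs_nonneg (x j)), Finset.sum_mul,
    ← Finset.sum_neg_distrib]
  simp_rw [abs_mul]

lemma pi_cauchyMeasure_real_abs_le {n : ℕ} (x : Fin n → ℝ) {r s : ℝ} (hr : 0 < r)
    (hx : ∑ j, |x j| = r) (hs : 0 ≤ s) :
    (Measure.pi fun _ : Fin n => cauchyMeasure).real {a | |∑ j, a j * x j| ≤ s * r} =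
      2 / Real.pi * Real.arctan s := by
  have h := congrArg (fun μ => μ.real (Set.Icc (-(s * r)) (s * r)))
    (map_sum_mul_pi_cauchyMeasure x)
  rw [map_measureReal_apply (by fun_prop) measurableSet_Icc,
    map_measureReal_apply (by fun_prop) measurableSet_Icc, hx] at h
  rw [← cauchyMeasure_real_Icc hs]
  convert h using 2
  · ext a
    simp [abs_le]
  · ext a
    simp only [Set.mem_Icc, Set.mem_preimage]
    rw [mul_comm s r, ← mul_neg, mul_le_mul_iff_right₀ hr, mul_le_mul_iff_right₀ hr]

lemma sub_div_le_arctan_sub_arctan {a b : ℝ} (ha : 0 ≤ a) (hab : a ≤ b) :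
    1 / (1 + b ^ 2) * (b - a) ≤ Real.arctan b - Real.arctan a := by
  refine (convex_Icc a b).mul_sub_le_image_sub_of_le_deriv Real.continuous_arctan.continuousOn
    Real.differentiable_arctan.differentiableOn ?_ a (Set.left_mem_Icc.2 hab) b
    (Set.right_mem_Icc.2 hab) hab
  intro x hx
  rw [interior_Icc] at hx
  simp only [Real.deriv_arctan]
  have h0 : 0 ≤ x := ha.trans hx.1.le
  have hxb : x ≤ b := hx.2.le
  gcongr

lemma two_div_pi_mul_arctan_one_sub_le {u : ℝ} (hu : 0 ≤ u) (hu1 : u ≤ 1) :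
    2 / Real.pi * Real.arctan (1 - u) ≤ 1 / 2 - u / 8 := by
  have h := sub_div_le_arctan_sub_arctan (sub_nonneg.2 hu1) (sub_le_self 1 hu)
  rw [Real.arctan_one] at h
  have hpi := Real.pi_pos
  have hpi4 := Real.pi_le_four
  rw [div_mul_eq_mul_div, div_le_iff₀ hpi]
  nlinarith

lemma le_two_div_pi_mul_arctan_one_add {u : ℝ} (hu : 0 ≤ u) (hu1 : u ≤ 1) :
    1 / 2 + u / 8 ≤ 2 / Real.pi * Real.arctan (1 + u) := by
  have h := sub_div_le_arctan_sub_arctan zero_le_one (le_add_of_nonneg_right hu)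
  rw [Real.arctan_one] at h
  have h5 : 1 / 5 * u ≤ 1 / (1 + (1 + u) ^ 2) * (1 + u - 1) := by
    rw [add_sub_cancel_left]
    gcongr
    nlinarith
  have hpi := Real.pi_pos
  have hpi4 := Real.pi_lt_d2
  rw [div_mul_eq_mul_div, le_div_iff₀ hpi]
  nlinarith

lemma one_sub_two_div_pi_mul_arctan_le {s : ℝ} (hs : 0 < s) :
    1 - 2 / Real.pi * Real.arctan s ≤ 1 / s := by
  have h := Real.arctan_inv_of_pos hs
  have hle : Real.arctan s⁻¹ ≤ s⁻¹ := by
    have := Real.le_tan (Real.arctan_nonneg.2 (inv_pos.2 hs).le) (Real.arctan_lt_pi_div_two s⁻¹)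
    rwa [Real.tan_arctan] at this
  have hpi := Real.pi_pos
  have hpi2 := Real.two_le_pi
  have : 1 - 2 / Real.pi * Real.arctan s = 2 / Real.pi * Real.arctan s⁻¹ := by
    rw [h]
    field_simp
  rw [this, one_div]
  calc 2 / Real.pi * Real.arctan s⁻¹ ≤ 2 / Real.pi * s⁻¹ := by gcongr
    _ ≤ 1 * s⁻¹ := by
      gcongr
      rwa [div_le_one hpi]
    _ = s⁻¹ := one_mul _

/-- The Hoeffding bound for the number of independent samples that fall in a given set. -/
lemma pi_real_le_card_filter_mem {m : ℕ} {β : Type*} [MeasurableSpace β] (ν : Measure β)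
    [IsProbabilityMeasure ν] {S : Set β} (hS : MeasurableSet S) {q u : ℝ} (hq : ν.real S ≤ q)
    (hu : 0 ≤ u) :
    (Measure.pi fun _ : Fin m => ν).real
      {ω | (q + u) * m ≤ ((Finset.univ.filter fun i => ω i ∈ S).card : ℝ)} ≤
      Real.exp (-(2 * u ^ 2 * m)) := by
  set X : β → ℝ := fun b => S.indicator 1 b - ν.real S with hX
  have hXm : Measurable X := (measurable_one.indicator hS).sub_const _
  have hind : ProbabilityTheory.iIndepFun (fun (i : Fin m) (ω : Fin m → β) => X (ω i))
      (Measure.pi fun _ : Fin m => ν) :=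
    ProbabilityTheory.iIndepFun_pi fun _ => hXm.aemeasurable
  have hsub : ProbabilityTheory.HasSubgaussianMGF X ((‖(1 : ℝ) - 0‖₊ / 2) ^ 2) ν := by
    have := ProbabilityTheory.hasSubgaussianMGF_of_mem_Icc (μ := ν) (a := 0) (b := 1)
      (X := S.indicator 1) (measurable_one.indicator hS).aemeasurable
      (Filter.Eventually.of_forall fun b => by
        by_cases hb : b ∈ S <;> simp [hb])
    rwa [integral_indicator_one hS] at this
  have hsub' : ∀ i ∈ (Finset.univ : Finset (Fin m)), ProbabilityTheory.HasSubgaussianMGF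
      (fun ω : Fin m → β => X (ω i)) ((‖(1 : ℝ) - 0‖₊ / 2) ^ 2)
      (Measure.pi fun _ : Fin m => ν) := by
    intro i _
    refine ProbabilityTheory.HasSubgaussianMGF.of_map (Y := fun ω : Fin m → β => ω i)
      (X := X) (measurable_pi_apply i).aemeasurable ?_
    rwa [(measurePreserving_eval (fun _ : Fin m => ν) i).map_eq]
  have h := ProbabilityTheory.HasSubgaussianMGF.measure_sum_ge_le_of_iIndepFun hind hsub'
    (ε := u * m) (by positivity)
  refine (measureReal_mono ?_).trans (h.trans_eq ?_)
  · intro ω hω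
    simp only [Set.mem_ofPred_eq, hX, Finset.sum_sub_distrib, Finset.sum_const, Finset.card_univ,
      Fintype.card_fin, nsmul_eq_mul, Set.indicator_apply, Pi.one_apply, Finset.sum_boole] at hω ⊢
    nlinarith [mul_le_mul_of_nonneg_left hq (Nat.cast_nonneg (α := ℝ) m)]
  · congr 1
    rcases Nat.eq_zero_or_pos m with rfl | hm
    · simp
    · have : (m : ℝ) ≠ 0 := by positivity
      simp
      field_simp

/-- An Auerbach basis of a subspace for the `ℓ₁` norm. -/
lemma exists_basis_abs_repr_le {n d : ℕ} (L : Submodule ℝ (Fin n → ℝ))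
    (hL : Module.finrank ℝ L = d) :
    ∃ v : Module.Basis (Fin d) ℝ L, (∀ k, ∑ i, |(v k : Fin n → ℝ) i| ≤ 1) ∧
      ∀ (z : L) (k), |v.repr z k| ≤ ∑ i, |(z : Fin n → ℝ) i| := by
  let b : Module.Basis (Fin d) ℝ L := Module.finBasisOfFinrankEq ℝ L hL
  let N : L → ℝ := fun z => ∑ i, |(z : Fin n → ℝ) i|
  have hNcont : Continuous N := by
    refine continuous_finsetSum _ fun i _ => ?_
    exact ((continuous_apply i).comp continuous_subtype_val).abs
  have hNsmul : ∀ (c : ℝ) z, N (c • z) = |c| * N z := by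
    intro c z
    simp [N, abs_mul, Finset.mul_sum]
  have hNpos : ∀ z, z ≠ 0 → 0 < N z := by
    intro z hz
    refine (Finset.sum_nonneg fun i _ => abs_nonneg _).lt_of_ne' fun h => hz ?_
    rw [Finset.sum_eq_zero_iff_of_nonneg fun i _ => abs_nonneg _] at h
    ext i
    simpa using h i (Finset.mem_univ i)
  have hcompact : IsCompact {z : L | N z ≤ 1} := by
    refine (isCompact_closedBall (0 : L) 1).of_isClosed_subset
      (isClosed_le hNcont continuous_const) ?_
    intro z hz
    rw [mem_closedBall_zero_iff, Submodule.coe_norm, pi_norm_le_iff_of_nonneg zero_le_one]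
    intro i
    exact (Finset.single_le_sum (f := fun i => |(z : Fin n → ℝ) i|)
      (fun i _ => abs_nonneg _) (Finset.mem_univ i)).trans hz
  have hcompact' := isCompact_univ_pi fun _ : Fin d => hcompact
  have hdet : Continuous fun w : Fin d → L => |b.det w| := by
    simp only [Module.Basis.det_apply]
    refine (Continuous.matrix_det ?_).abs
    refine continuous_matrix fun i j => ?_
    simp only [Module.Basis.toMatrix_apply]
    exact (LinearMap.continuous_of_finiteDimensional (b.coord i)).comp (continuous_apply j)
  obtain ⟨w, hw, hmax⟩ := hcompact'.exists_isMaxOn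
    ⟨0, fun i _ => by simp [N]⟩ hdet.continuousOn
  have hw1 : ∀ k, N (w k) ≤ 1 := fun k => hw k (Set.mem_univ k)
  have hdetpos : b.det w ≠ 0 := by
    have hb0 : ∀ k, 0 < N (b k) := fun k => hNpos _ (b.ne_zero k)
    have hle := hmax (a := fun k => (N (b k))⁻¹ • b k) fun k _ => by
      simp only [Set.mem_ofPred_eq, hNsmul]
      rw [abs_of_pos (inv_pos.2 (hb0 k)), inv_mul_cancel₀ (hb0 k).ne']
    have hval : b.det (fun k => (N (b k))⁻¹ • b k) = ∏ k, (N (b k))⁻¹ := by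
      have := b.det.map_smul_univ (fun k => (N (b k))⁻¹) b
      rw [this, b.det_self]
      simp
    simp only [Set.mem_ofPred_eq, hval] at hle
    have : 0 < ∏ k, (N (b k))⁻¹ := Finset.prod_pos fun k _ => inv_pos.2 (hb0 k)
    intro h0
    rw [h0, abs_zero, abs_of_pos this] at hle
    linarith
  obtain ⟨hli, hsp⟩ := (b.is_basis_iff_det (v := w)).2 (isUnit_iff_ne_zero.2 hdetpos)
  let v : Module.Basis (Fin d) ℝ L := Module.Basis.mk hli hsp.ge
  have hv : ⇑v = w := Module.Basis.coe_mk hli hsp.ge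
  have key : ∀ (z : L) k, b.det (Function.update w k z) = b.det w * v.repr z k := by
    intro z k
    have h1 := b.det.eq_smul_basis_det v
    have h2 : v.det (Function.update v k z) = v.repr z k := by
      rw [Module.Basis.det_apply, Module.Basis.toMatrix_update, Module.Basis.toMatrix_self,
        ← Matrix.cramer_apply, Matrix.cramer_one]
      rfl
    rw [← hv, h1, AlternatingMap.smul_apply, h2, AlternatingMap.smul_apply, v.det_self]
    simp
  have hle1 : ∀ (z : L) k, N z ≤ 1 → |v.repr z k| ≤ 1 := by
    intro z k hz
    have hle := hmax (a := Function.update w k z) fun j _ => by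
      by_cases hj : j = k
      · subst hj
        simpa using hz
      · simpa [hj] using hw1 j
    simp only [Set.mem_ofPred_eq, key, abs_mul] at hle
    exact le_of_mul_le_mul_left (by simpa using hle) (abs_pos.2 hdetpos)
  refine ⟨v, fun k => by rw [hv]; exact hw1 k, fun z k => ?_⟩
  rcases eq_or_ne z 0 with rfl | hz
  · simp
  have hz0 := hNpos z hz
  have := hle1 ((N z)⁻¹ • z) k (by
    rw [hNsmul, abs_of_pos (inv_pos.2 hz0), inv_mul_cancel₀ hz0.ne'])
  rw [map_smul, Finsupp.smul_apply, smul_eq_mul, abs_mul, abs_of_pos (inv_pos.2 hz0),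
    inv_mul_le_iff₀ hz0, mul_one] at this
  exact this

lemma le_medNorm {m : ℕ} {v : Fin m → ℝ} {c : ℝ}
    (h : 2 * (Finset.univ.filter fun i => |v i| < c).card < m) : c ≤ medNorm v := by
  refine le_csInf ⟨∑ i, |v i|, ?_⟩ fun t ht => ?_
  · have : (Finset.univ.filter fun i => |v i| ≤ ∑ i, |v i|) = Finset.univ :=
      Finset.filter_true_of_mem fun i hi =>
        Finset.single_le_sum (f := fun i => |v i|) (fun i _ => abs_nonneg _) hi
    rw [Set.mem_ofPred_eq, this, Finset.card_univ, Fintype.card_fin]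
    omega
  · by_contra! htc
    have hle : (Finset.univ.filter fun i => |v i| ≤ t).card ≤
        (Finset.univ.filter fun i => |v i| < c).card :=
      Finset.card_le_card (Finset.monotone_filter_right _ fun i _ hi => lt_of_le_of_lt hi htc)
    rw [Set.mem_ofPred_eq] at ht
    omega

lemma medNorm_le {m : ℕ} {v : Fin m → ℝ} {c : ℝ} (hm : 0 < m)
    (h : 2 * (Finset.univ.filter fun i => c < |v i|).card ≤ m) : medNorm v ≤ c := by
  refine csInf_le ⟨0, fun t ht => ?_⟩ ?_
  · by_contra! ht0
    have : (Finset.univ.filter fun i => |v i| ≤ t) = ∅ :=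
      Finset.filter_false_of_mem fun i _ => not_le.2 (ht0.trans_le (abs_nonneg _))
    rw [Set.mem_ofPred_eq, this, Finset.card_empty] at ht
    omega
  · have := Finset.card_filter_add_card_filter_not (s := (Finset.univ : Finset (Fin m)))
      (fun i => |v i| ≤ c)
    simp only [not_le, Finset.card_univ, Fintype.card_fin] at this
    rw [Set.mem_ofPred_eq]
    omega

lemma medNorm_zero {m : ℕ} (hm : 0 < m) : medNorm (fun _ : Fin m => (0 : ℝ)) = 0 :=
  le_antisymm (medNorm_le hm (by simp)) (le_medNorm (by simpa using hm))

/-- If `a` is close to `b` outside a small set of indices, then quantile bounds for `b` bound the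
median of multiples of `a`. -/
lemma medNorm_mul_bounds {m : ℕ} {a b : Fin m → ℝ} {B : Finset (Fin m)} {r s ε : ℝ}
    (hε : 0 < ε) (hε1 : ε < 1) (hs : 0 < s) (hr : |r - 1| ≤ ε / 256)
    (hab : ∀ i ∉ B, |a i - b i| ≤ ε / 4) (hB : (B.card : ℝ) < ε / 32 * m)
    (hlow : ((Finset.univ.filter fun i => |b i| ≤ (1 - ε / 2) * r).card : ℝ) <
      (1 / 2 - ε / 32) * m)
    (hup : ((Finset.univ.filter fun i => (1 + ε / 2) * r < |b i|).card : ℝ) <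
      (1 / 2 - ε / 32) * m) :
    (1 - ε) * s ≤ medNorm (fun i => s * a i) ∧ medNorm (fun i => s * a i) ≤ (1 + ε) * s := by
  have hm : 0 < m := by
    rcases Nat.eq_zero_or_pos m with rfl | hm
    · have : (0 : ℝ) ≤ B.card := by positivity
      simp at hB
      linarith
    · exact hm
  obtain ⟨hr1, hr2⟩ := abs_le.1 hr
  constructor
  · apply le_medNorm
    have hsub : (Finset.univ.filter fun i => |s * a i| < (1 - ε) * s) ⊆
        B ∪ Finset.univ.filter fun i => |b i| ≤ (1 - ε / 2) * r := by
      intro i hi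
      rw [Finset.mem_filter_univ, abs_mul, abs_of_pos hs, mul_comm,
        mul_lt_mul_iff_left₀ hs] at hi
      rw [Finset.mem_union, Finset.mem_filter_univ, or_iff_not_imp_left]
      intro hiB
      have h1 := hab i hiB
      have h2 := abs_sub_abs_le_abs_sub (b i) (a i)
      rw [abs_sub_comm] at h2
      nlinarith
    have hcard := (Finset.card_le_card hsub).trans (Finset.card_union_le _ _)
    have : ((2 * (Finset.univ.filter fun i => |s * a i| < (1 - ε) * s).card : ℕ) : ℝ) < m := by
      have : ((Finset.univ.filter fun i => |s * a i| < (1 - ε) * s).card : ℝ) ≤ _ :=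
        Nat.cast_le.2 hcard
      push_cast at this ⊢
      linarith
    exact_mod_cast this
  · apply medNorm_le hm
    have hsub : (Finset.univ.filter fun i => (1 + ε) * s < |s * a i|) ⊆
        B ∪ Finset.univ.filter fun i => (1 + ε / 2) * r < |b i| := by
      intro i hi
      rw [Finset.mem_filter_univ, abs_mul, abs_of_pos hs, mul_comm s,
        mul_lt_mul_iff_left₀ hs] at hi
      rw [Finset.mem_union, Finset.mem_filter_univ, or_iff_not_imp_left]
      intro hiB
      have h1 := hab i hiB
      have h2 := abs_sub_abs_le_abs_sub (a i) (b i)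
      nlinarith
    have hcard := (Finset.card_le_card hsub).trans (Finset.card_union_le _ _)
    have : ((2 * (Finset.univ.filter fun i => (1 + ε) * s < |s * a i|).card : ℕ) : ℝ) ≤ m := by
      have : ((Finset.univ.filter fun i => (1 + ε) * s < |s * a i|).card : ℝ) ≤ _ :=
        Nat.cast_le.2 hcard
      push_cast at this ⊢
      linarith
    exact_mod_cast this

/-- Every point of the cube `[-1, 1]ᵈ` is within `1 / K` of a point of the grid `K⁻¹ ℤᵈ` in it. -/
lemma exists_int_grid_near {d K : ℕ} (hK : 0 < K) {c : Fin d → ℝ} (hc : ∀ k, |c k| ≤ 1) :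
    ∃ z ∈ Fintype.piFinset fun _ : Fin d => Finset.Icc (-(K : ℤ)) K,
      ∀ k, |c k - z k / K| ≤ 1 / K := by
  have hK' : (0 : ℝ) < K := by exact_mod_cast hK
  refine ⟨fun k => ⌊c k * K⌋, ?_, fun k => ?_⟩
  · rw [Fintype.mem_piFinset]
    intro k
    obtain ⟨h1, h2⟩ := abs_le.1 (hc k)
    rw [Finset.mem_Icc]
    constructor
    · rw [Int.le_floor]
      push_cast
      nlinarith
    · rw [← Int.cast_le (R := ℝ)]
      refine (Int.floor_le _).trans ?_
      push_cast
      nlinarith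
  · rw [show c k - (⌊c k * K⌋ : ℝ) / K = (c k * K - ⌊c k * K⌋) / K by field_simp, abs_div,
      abs_of_pos hK', Int.self_sub_floor, Int.abs_fract]
    gcongr
    exact (Int.fract_lt_one _).le

lemma card_int_grid (d K : ℕ) :
    (Fintype.piFinset fun _ : Fin d => Finset.Icc (-(K : ℤ)) K).card = (2 * K + 1) ^ d := by
  rw [Fintype.card_piFinset_const, Int.card_Icc]
  congr 1
  omega

lemma abs_sum_mul_sum_mul_le {ι κ : Type*} [Fintype ι] [Fintype κ] (a : ι → ℝ) (v : κ → ι → ℝ)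
    {c : κ → ℝ} {η : ℝ} (hc : ∀ k, |c k| ≤ η) :
    |∑ j, a j * ∑ k, c k * v k j| ≤ η * ∑ k, |∑ j, a j * v k j| := by
  have : ∑ j, a j * ∑ k, c k * v k j = ∑ k, c k * ∑ j, a j * v k j := by
    simp_rw [Finset.mul_sum]
    rw [Finset.sum_comm]
    exact Finset.sum_congr rfl fun k _ => Finset.sum_congr rfl fun j _ => by ring
  rw [this, Finset.mul_sum]
  refine (Finset.abs_sum_le_sum_abs _ _).trans (Finset.sum_le_sum fun k _ => ?_)
  rw [abs_mul]
  exact mul_le_mul_of_nonneg_right (hc k) (abs_nonneg _)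

lemma sum_abs_sum_mul_le {ι κ : Type*} [Fintype ι] [Fintype κ] {v : κ → ι → ℝ}
    (hv : ∀ k, ∑ i, |v k i| ≤ 1) {c : κ → ℝ} {η : ℝ} (hc : ∀ k, |c k| ≤ η) :
    ∑ i, |∑ k, c k * v k i| ≤ Fintype.card κ * η := by
  calc ∑ i, |∑ k, c k * v k i| ≤ ∑ i, ∑ k, |c k| * |v k i| := by
        refine Finset.sum_le_sum fun i _ => (Finset.abs_sum_le_sum_abs _ _).trans_eq ?_
        simp_rw [abs_mul]
    _ = ∑ k, |c k| * ∑ i, |v k i| := by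
        rw [Finset.sum_comm]
        simp_rw [Finset.mul_sum]
    _ ≤ ∑ _k : κ, η := by
        refine Finset.sum_le_sum fun k _ => ?_
        calc |c k| * ∑ i, |v k i| ≤ |c k| * 1 := by gcongr; exact hv k
          _ ≤ η := by rw [mul_one]; exact hc k
    _ = Fintype.card κ * η := by simp

section Tail

variable {n m : ℕ} {ε : ℝ}

lemma pi_cauchyMeasure_real_low {w : Fin n → ℝ} {r : ℝ} (hr : 0 < r) (hw : ∑ j, |w j| = r)
    (hε : 0 < ε) (hε1 : ε < 1) :
    (Measure.pi fun _ : Fin m => Measure.pi fun _ : Fin n => cauchyMeasure).real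
      {ω | (1 / 2 - ε / 32) * m ≤
        ((Finset.univ.filter fun i => |∑ j, ω i j * w j| ≤ (1 - ε / 2) * r).card : ℝ)} ≤
      Real.exp (-(ε ^ 2 * m / 2048)) := by
  have hq := (pi_cauchyMeasure_real_abs_le w hr hw (s := 1 - ε / 2) (by linarith)).trans_le
    (two_div_pi_mul_arctan_one_sub_le (u := ε / 2) (by linarith) (by linarith))
  have h := pi_real_le_card_filter_mem (m := m) (Measure.pi fun _ : Fin n => cauchyMeasure)
    (measurableSet_le (by fun_prop) measurable_const) hq (u := ε / 32) (by linarith)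
  refine (le_of_eq ?_).trans (h.trans ?_)
  · congr 1
    ext ω
    simp only [Set.mem_ofPred_eq]
    rw [show 1 / 2 - ε / 2 / 8 + ε / 32 = 1 / 2 - ε / 32 by ring]
  · rw [Real.exp_le_exp]
    have : 0 ≤ ε ^ 2 * m := by positivity
    nlinarith

lemma pi_cauchyMeasure_real_high {w : Fin n → ℝ} {r : ℝ} (hr : 0 < r) (hw : ∑ j, |w j| = r)
    (hε : 0 < ε) (hε1 : ε < 1) :
    (Measure.pi fun _ : Fin m => Measure.pi fun _ : Fin n => cauchyMeasure).real
      {ω | (1 / 2 - ε / 32) * m ≤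
        ((Finset.univ.filter fun i => (1 + ε / 2) * r < |∑ j, ω i j * w j|).card : ℝ)} ≤
      Real.exp (-(ε ^ 2 * m / 2048)) := by
  have hS : MeasurableSet {a : Fin n → ℝ | |∑ j, a j * w j| ≤ (1 + ε / 2) * r} :=
    measurableSet_le (by fun_prop) measurable_const
  have hq : (Measure.pi fun _ : Fin n => cauchyMeasure).real
      {a : Fin n → ℝ | |∑ j, a j * w j| ≤ (1 + ε / 2) * r}ᶜ ≤ 1 / 2 - ε / 2 / 8 := by
    rw [probReal_compl_eq_one_sub hS,
      pi_cauchyMeasure_real_abs_le w hr hw (s := 1 + ε / 2) (by linarith)]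
    have := le_two_div_pi_mul_arctan_one_add (u := ε / 2) (by linarith) (by linarith)
    linarith
  have h := pi_real_le_card_filter_mem (m := m) _ hS.compl hq (u := ε / 32) (by linarith)
  refine (le_of_eq ?_).trans (h.trans ?_)
  · congr 1
    ext ω
    simp only [Set.mem_ofPred_eq, Set.mem_compl_iff, not_le]
    rw [show 1 / 2 - ε / 2 / 8 + ε / 32 = 1 / 2 - ε / 32 by ring]
  · rw [Real.exp_le_exp]
    have : 0 ≤ ε ^ 2 * m := by positivity
    nlinarith

lemma pi_cauchyMeasure_real_sum_abs {d : ℕ} (hd : 1 ≤ d) {v : Fin d → Fin n → ℝ}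
    (hv0 : ∀ k, 0 < ∑ j, |v k j|) (hv : ∀ k, ∑ j, |v k j| ≤ 1) (hε : 0 < ε) :
    (Measure.pi fun _ : Fin m => Measure.pi fun _ : Fin n => cauchyMeasure).real
      {ω | ε / 32 * m ≤ ((Finset.univ.filter fun i =>
        d * (64 * d / ε) < ∑ k, |∑ j, ω i j * v k j|).card : ℝ)} ≤
      Real.exp (-(ε ^ 2 * m / 2048)) := by
  have hd0 : (0 : ℝ) < d := by exact_mod_cast hd
  set t : ℝ := 64 * d / ε with ht
  have ht0 : 0 < t := by positivity
  set ν := Measure.pi fun _ : Fin n => cauchyMeasure with hν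
  have hS : MeasurableSet {a : Fin n → ℝ | d * t < ∑ k, |∑ j, a j * v k j|} :=
    measurableSet_lt measurable_const (by fun_prop)
  have htail : ∀ k, ν.real {a : Fin n → ℝ | |∑ j, a j * v k j| ≤ t}ᶜ ≤ 1 / t := by
    intro k
    rw [probReal_compl_eq_one_sub (measurableSet_le (by fun_prop) measurable_const)]
    have h1 := pi_cauchyMeasure_real_abs_le (v k) (hv0 k) rfl ht0.le
    have h2 := one_sub_two_div_pi_mul_arctan_le ht0
    have h3 : ν.real {a | |∑ j, a j * v k j| ≤ t * ∑ j, |v k j|} ≤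
        ν.real {a | |∑ j, a j * v k j| ≤ t} :=
      measureReal_mono fun a ha => le_trans ha (mul_le_of_le_one_right ht0.le (hv k))
    linarith
  have hq : ν.real {a : Fin n → ℝ | d * t < ∑ k, |∑ j, a j * v k j|} ≤ ε / 64 := by
    have hsub : {a : Fin n → ℝ | d * t < ∑ k, |∑ j, a j * v k j|} ⊆
        ⋃ k ∈ (Finset.univ : Finset (Fin d)), {a : Fin n → ℝ | |∑ j, a j * v k j| ≤ t}ᶜ := by
      intro a ha
      by_contra hcon
      simp only [Finset.mem_univ, Set.iUnion_true, Set.mem_iUnion, Set.mem_compl_iff, not_exists,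
        not_not, Set.mem_ofPred_eq] at hcon ha
      have := Finset.sum_le_sum fun k (_ : k ∈ Finset.univ) => hcon k
      simp at this
      linarith
    calc _ ≤ _ := measureReal_mono hsub (measure_ne_top _ _)
      _ ≤ ∑ k, ν.real {a : Fin n → ℝ | |∑ j, a j * v k j| ≤ t}ᶜ :=
        measureReal_biUnion_finset_le _ _
      _ ≤ ∑ _k : Fin d, 1 / t := Finset.sum_le_sum fun k _ => htail k
      _ = ε / 64 := by
        simp [ht]
        field_simp
  have h := pi_real_le_card_filter_mem (m := m) _ hS hq (u := ε / 64) (by linarith)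
  refine (le_of_eq ?_).trans (h.trans_eq ?_)
  · congr 1
    ext ω
    simp only [Set.mem_ofPred_eq]
    rw [show ε / 64 + ε / 64 = ε / 32 by ring]
  · congr 1
    ring

end Tail

/-- The event that a sketching matrix with the given rows preserves the `ℓ₁` norm on `L` up to a
factor `1 ± ε`. -/
def medianEmbeddingEvent {n : ℕ} (m : ℕ) (L : Submodule ℝ (Fin n → ℝ)) (ε : ℝ) :
    Set (Fin m → Fin n → ℝ) :=
  {ω | ∀ x ∈ L,
    (1 - ε) * (∑ i, |x i|) ≤ medNorm (fun i : Fin m => ∑ j, ω i j * x j) ∧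
    medNorm (fun i : Fin m => ∑ j, ω i j * x j) ≤ (1 + ε) * (∑ i, |x i|)}

lemma pi_cauchyMeasure_real_compl_le {n d m : ℕ} (hd : 1 ≤ d) {ε : ℝ} (hε : 0 < ε) (hε1 : ε < 1)
    {L : Submodule ℝ (Fin n → ℝ)} (hL : Module.finrank ℝ L = d) {K : ℕ}
    (hK : 256 * d ^ 2 / ε ^ 2 ≤ K) :
    (Measure.pi fun _ : Fin m => Measure.pi fun _ : Fin n => cauchyMeasure).real
      (medianEmbeddingEvent m L ε)ᶜ ≤
      (2 * (2 * K + 1) ^ d + 1) * Real.exp (-(ε ^ 2 * m / 2048)) := by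
  obtain ⟨v, hv1, hrepr⟩ := exists_basis_abs_repr_le L hL
  have hd1 : (1 : ℝ) ≤ d := by exact_mod_cast hd
  have hd0 : (0 : ℝ) < d := by linarith
  have hK0 : (0 : ℝ) < K := lt_of_lt_of_le (by positivity) hK
  rw [div_le_iff₀ (by positivity)] at hK
  set P := Measure.pi fun _ : Fin m => Measure.pi fun _ : Fin n => cauchyMeasure with hP
  set e := Real.exp (-(ε ^ 2 * m / 2048)) with he
  set V : Fin d → Fin n → ℝ := fun k => (v k : Fin n → ℝ) with hV
  have hv0 : ∀ k, 0 < ∑ j, |V k j| := by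
    intro k
    have := hrepr (v k) k
    simp only [Module.Basis.repr_self, Finsupp.single_eq_same, abs_one] at this
    linarith
  set w : (Fin d → ℤ) → Fin n → ℝ := fun z j => ∑ k, (z k : ℝ) / K * V k j with hw
  set G := Fintype.piFinset fun _ : Fin d => Finset.Icc (-(K : ℤ)) K with hG
  set G' := G.filter fun z => 0 < ∑ j, |w z j| with hG'
  set E₁ : (Fin d → ℤ) → Set (Fin m → Fin n → ℝ) := fun z => {ω | (1 / 2 - ε / 32) * m ≤
    ((Finset.univ.filter fun i =>
      |∑ j, ω i j * w z j| ≤ (1 - ε / 2) * ∑ j, |w z j|).card : ℝ)} with hE₁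
  set E₂ : (Fin d → ℤ) → Set (Fin m → Fin n → ℝ) := fun z => {ω | (1 / 2 - ε / 32) * m ≤
    ((Finset.univ.filter fun i =>
      (1 + ε / 2) * ∑ j, |w z j| < |∑ j, ω i j * w z j|).card : ℝ)} with hE₂
  set E₃ : Set (Fin m → Fin n → ℝ) := {ω | ε / 32 * m ≤ ((Finset.univ.filter fun i =>
        d * (64 * d / ε) < ∑ k, |∑ j, ω i j * V k j|).card : ℝ)} with hE₃
  have hsub : (medianEmbeddingEvent m L ε)ᶜ ⊆ (⋃ z ∈ G', (E₁ z ∪ E₂ z)) ∪ E₃ := by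
    intro ω hω
    by_contra hcon
    refine hω fun x hx => ?_
    rw [Set.mem_union, not_or] at hcon
    obtain ⟨hcon, h3⟩ := hcon
    simp only [Set.mem_iUnion, not_exists, Set.mem_union, not_or, hE₁, hE₂, hE₃,
      Set.mem_ofPred_eq, not_le] at hcon h3
    have hm : 0 < m := by
      rcases Nat.eq_zero_or_pos m with rfl | hm
      · simp at h3
      · exact hm
    set s := ∑ i, |x i| with hs
    rcases (Finset.sum_nonneg fun i _ => abs_nonneg (x i) : 0 ≤ ∑ i, |x i|).eq_or_lt with h0 | hs0
    · have hx0 : ∀ i, x i = 0 := by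
        have := (Finset.sum_eq_zero_iff_of_nonneg fun i _ => abs_nonneg (x i)).1 h0.symm
        simpa using this
      simp [hs, hx0, medNorm_zero hm]
    replace hs0 : 0 < s := hs0
    set y : L := s⁻¹ • ⟨x, hx⟩ with hy
    have hyx : ∀ j, x j = s * (y : Fin n → ℝ) j := by
      intro j
      simp only [hy, Submodule.coe_smul, Pi.smul_apply, smul_eq_mul]
      rw [mul_inv_cancel_left₀ hs0.ne']
    have hNy : ∑ j, |(y : Fin n → ℝ) j| = 1 := by
      have : s = s * ∑ j, |(y : Fin n → ℝ) j| := by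
        rw [Finset.mul_sum]
        conv_lhs => rw [hs]
        refine Finset.sum_congr rfl fun j _ => ?_
        rw [hyx j, abs_mul, abs_of_pos hs0]
      exact (mul_eq_left₀ hs0.ne').1 this.symm
    obtain ⟨z, hz, hzc⟩ := exists_int_grid_near (K := K) (by exact_mod_cast hK0)
      (c := fun k => v.repr y k) fun k => (hrepr y k).trans_eq hNy
    have hyw : ∀ j, (y : Fin n → ℝ) j - w z j = ∑ k, (v.repr y k - z k / K) * V k j := by
      intro j
      have h1 : (y : Fin n → ℝ) j = ∑ k, v.repr y k * V k j := by
        have := congrArg (fun u : L => (u : Fin n → ℝ) j) (v.sum_repr y)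
        simp only [Submodule.coe_sum, Finset.sum_apply, Submodule.coe_smul, Pi.smul_apply,
          smul_eq_mul] at this
        exact this.symm
      rw [h1, hw]
      simp only [sub_mul, Finset.sum_sub_distrib]
    have hdK : (d : ℝ) * (1 / K) ≤ ε / 256 := by
      rw [mul_one_div, div_le_iff₀ hK0]
      have h1 : 256 * (d : ℝ) ≤ 256 * d ^ 2 := by nlinarith
      have h2 : ε ^ 2 * K ≤ ε * K := by nlinarith
      nlinarith
    have hr : |∑ j, |w z j| - 1| ≤ ε / 256 := by
      rw [← hNy, ← Finset.sum_sub_distrib]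
      refine (Finset.abs_sum_le_sum_abs _ _).trans ?_
      refine (Finset.sum_le_sum fun j _ => abs_abs_sub_abs_le_abs_sub (w z j) _).trans ?_
      simp_rw [abs_sub_comm (w z _), hyw]
      have := sum_abs_sum_mul_le hv1 hzc
      rw [Fintype.card_fin] at this
      exact this.trans hdK
    have hzG : z ∈ G' := by
      rw [hG', Finset.mem_filter]
      refine ⟨hz, ?_⟩
      linarith [(abs_le.1 hr).1]
    obtain ⟨h1, h2⟩ := hcon z hzG
    have hmain := medNorm_mul_bounds (a := fun i => ∑ j, ω i j * (y : Fin n → ℝ) j) hε hε1 hs0 hr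
      (fun i hi => ?_) h3 h1 h2
    · have : ∀ i, s * ∑ j, ω i j * (y : Fin n → ℝ) j = ∑ j, ω i j * x j := by
        intro i
        rw [Finset.mul_sum]
        refine Finset.sum_congr rfl fun j _ => ?_
        rw [hyx j]
        ring
      simpa only [this] using hmain
    · rw [Finset.mem_filter_univ, not_lt] at hi
      rw [← Finset.sum_sub_distrib]
      simp_rw [← mul_sub, hyw]
      refine (abs_sum_mul_sum_mul_le (ω i) V hzc).trans ?_
      calc 1 / (K : ℝ) * ∑ k, |∑ j, ω i j * V k j| ≤ 1 / K * (d * (64 * d / ε)) := by gcongr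
        _ = 64 * d ^ 2 / (ε * K) := by field_simp
        _ ≤ ε / 4 := by
          rw [div_le_iff₀ (by positivity)]
          nlinarith
  have hcard : (G'.card : ℝ) ≤ (2 * K + 1) ^ d := by
    have := Finset.card_filter_le G fun z => 0 < ∑ j, |w z j|
    rw [card_int_grid] at this
    exact_mod_cast this
  have hE₃le : P.real E₃ ≤ e := pi_cauchyMeasure_real_sum_abs hd hv0 hv1 hε
  calc P.real (medianEmbeddingEvent m L ε)ᶜ
      ≤ P.real ((⋃ z ∈ G', (E₁ z ∪ E₂ z)) ∪ E₃) := measureReal_mono hsub (measure_ne_top _ _)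
    _ ≤ P.real (⋃ z ∈ G', (E₁ z ∪ E₂ z)) + P.real E₃ := measureReal_union_le _ _
    _ ≤ ∑ z ∈ G', (e + e) + e := by
      refine add_le_add ((measureReal_biUnion_finset_le _ _).trans
        (Finset.sum_le_sum fun z hz => (measureReal_union_le _ _).trans ?_)) hE₃le
      have hpos := (Finset.mem_filter.1 hz).2
      exact add_le_add (pi_cauchyMeasure_real_low hpos rfl hε hε1)
        (pi_cauchyMeasure_real_high hpos rfl hε hε1)
    _ = (2 * G'.card + 1) * e := by
      rw [Finset.sum_const, nsmul_eq_mul]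
      ring
    _ ≤ (2 * (2 * K + 1) ^ d + 1) * e := by gcongr

/-- For a line and distortion larger than `1 / 2`, even few rows succeed with positive
probability. -/
lemma le_pi_cauchyMeasure_real_of_finrank_eq_one {n m : ℕ} (hm : 0 < m) {ε : ℝ} (hε : 1 / 2 < ε)
    {L : Submodule ℝ (Fin n → ℝ)} (hL : Module.finrank ℝ L = 1) :
    (1 / 8) ^ m ≤
      (Measure.pi fun _ : Fin m => Measure.pi fun _ : Fin n => cauchyMeasure).real
        (medianEmbeddingEvent m L ε) := by
  obtain ⟨v, hv1, hrepr⟩ := exists_basis_abs_repr_le L hL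
  set u : Fin n → ℝ := (v 0 : Fin n → ℝ) with hu
  have hr0 : 0 < ∑ j, |u j| := by
    have := hrepr (v 0) 0
    simp only [Module.Basis.repr_self, Finsupp.single_eq_same, abs_one] at this
    linarith
  set r := ∑ j, |u j| with hr
  set ν := Measure.pi fun _ : Fin n => cauchyMeasure with hν
  set S : Set (Fin n → ℝ) := {a | |∑ j, a j * u j| ≤ (1 + 1 / 2) * r} \
    {a | |∑ j, a j * u j| ≤ (1 - 1 / 2) * r} with hS
  have hSν : 1 / 8 ≤ ν.real S := by
    have h := le_measureReal_sdiff (μ := ν) (s₁ := {a | |∑ j, a j * u j| ≤ (1 + 1 / 2) * r})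
      (s₂ := {a | |∑ j, a j * u j| ≤ (1 - 1 / 2) * r})
    rw [pi_cauchyMeasure_real_abs_le u hr0 rfl (by norm_num),
      pi_cauchyMeasure_real_abs_le u hr0 rfl (by norm_num)] at h
    change _ ≤ ν.real S at h
    have h1 := two_div_pi_mul_arctan_one_sub_le (u := 1 / 2) (by norm_num) (by norm_num)
    have h2 := le_two_div_pi_mul_arctan_one_add (u := 1 / 2) (by norm_num) (by norm_num)
    linarith
  have hsub : Set.univ.pi (fun _ : Fin m => S) ⊆ medianEmbeddingEvent m L ε := by
    intro ω hω x hx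
    obtain ⟨c, hc⟩ : ∃ c : ℝ, x = c • u := by
      refine ⟨v.repr ⟨x, hx⟩ 0, ?_⟩
      have := congrArg Subtype.val (v.sum_repr ⟨x, hx⟩)
      simpa using this.symm
    have hx1 : ∑ j, |x j| = |c| * r := by
      simp [hc, abs_mul, Finset.mul_sum, hr]
    have hx2 : ∀ i, |∑ j, ω i j * x j| = |c| * |∑ j, ω i j * u j| := by
      intro i
      rw [← abs_mul, Finset.mul_sum, hc]
      congr 1
      refine Finset.sum_congr rfl fun j _ => ?_
      simp only [Pi.smul_apply, smul_eq_mul]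
      ring
    have hbound : ∀ i, (1 - ε) * (|c| * r) ≤ |∑ j, ω i j * x j| ∧
        |∑ j, ω i j * x j| ≤ (1 + ε) * (|c| * r) := by
      intro i
      obtain ⟨h1, h2⟩ := hω i (Set.mem_univ i)
      rw [Set.mem_ofPred_eq] at h1 h2
      rw [not_le] at h2
      rw [hx2, mul_left_comm, mul_left_comm (1 + ε)]
      constructor <;> gcongr <;> nlinarith
    rw [hx1]
    refine ⟨le_medNorm ?_, medNorm_le hm ?_⟩
    · rw [Finset.filter_false_of_mem fun i _ => not_lt.2 (hbound i).1]
      simpa using hm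
    · rw [Finset.filter_false_of_mem fun i _ => not_lt.2 (hbound i).2]
      simp
  calc (1 / 8 : ℝ) ^ m ≤ ν.real S ^ m := by gcongr
    _ = (Measure.pi fun _ : Fin m => ν).real (Set.univ.pi fun _ => S) := by
      simp [measureReal_def, Measure.pi_pi]
    _ ≤ _ := measureReal_mono hsub (measure_ne_top _ _)

lemma one_sub_le_pi_cauchyMeasure_real {n m : ℕ} {ε δ : ℝ} {L : Submodule ℝ (Fin n → ℝ)}
    (h : (Measure.pi fun _ : Fin m => Measure.pi fun _ : Fin n => cauchyMeasure).real
      (medianEmbeddingEvent m L ε)ᶜ ≤ δ) :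
    1 - δ ≤ (Measure.pi fun _ : Fin m => Measure.pi fun _ : Fin n => cauchyMeasure).real
      (medianEmbeddingEvent m L ε) := by
  have := measureReal_union_le (μ := Measure.pi fun _ : Fin m =>
    Measure.pi fun _ : Fin n => cauchyMeasure) (medianEmbeddingEvent m L ε)
    (medianEmbeddingEvent m L ε)ᶜ
  rw [Set.union_compl_self, probReal_univ] at this
  linarith

lemma map_uncurry_pi_cauchyMeasure (m n : ℕ) :
    (Measure.pi fun _ : Fin m => Measure.pi fun _ : Fin n => cauchyMeasure).map
      (fun ω (p : Fin m × Fin n) => ω p.1 p.2) =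
    Measure.pi fun _ : Fin m × Fin n => cauchyMeasure := by
  symm
  refine Measure.pi_eq fun s hs => ?_
  rw [Measure.map_apply (by fun_prop) (MeasurableSet.univ_pi hs)]
  have : (fun (ω : Fin m → Fin n → ℝ) (p : Fin m × Fin n) => ω p.1 p.2) ⁻¹' Set.univ.pi s =
      Set.univ.pi fun i => Set.univ.pi fun j => s (i, j) := by
    ext ω
    simp [Set.mem_pi, Prod.forall]
  rw [this, Measure.pi_pi]
  simp_rw [Measure.pi_pi, Fintype.prod_prod_type]

lemma grid_mul_exp_le {d m K : ℕ} (hd : 1 ≤ d) {ε δ : ℝ} (hε : 0 < ε) (hε1 : ε < 1) (hδ : 0 < δ)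
    (hδ1 : δ < 1) (hlarge : 2 ≤ d / (ε * δ)) (hK : K ≤ 257 * d ^ 2 / ε ^ 2)
    (hm : 30720 * ((d : ℝ) / ε ^ 2) * Real.log ((d : ℝ) / (ε * δ)) ≤ m) :
    (2 * (2 * K + 1) ^ d + 1) * Real.exp (-(ε ^ 2 * m / 2048)) ≤ δ := by
  set Λ := (d : ℝ) / (ε * δ) with hΛ
  have hd1 : (1 : ℝ) ≤ d := by exact_mod_cast hd
  have hΛ0 : 0 < Λ := by linarith
  have hΛ1 : 1 ≤ Λ := by linarith
  have hdε : (d : ℝ) / ε ≤ Λ := by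
    rw [hΛ]
    gcongr
    nlinarith
  have hdε1 : 1 ≤ (d : ℝ) / ε := by
    rw [le_div_iff₀ hε]
    linarith
  have hgrid : 2 * (K : ℝ) + 1 ≤ Λ ^ 12 := by
    have h1 : (d : ℝ) ^ 2 / ε ^ 2 ≤ Λ ^ 2 := by
      rw [← div_pow]
      gcongr
    have h2 : (2 : ℝ) ^ 10 ≤ Λ ^ 10 := by gcongr
    have h3 : 1 ≤ Λ ^ 2 := one_le_pow₀ hΛ1
    rw [mul_div_assoc] at hK
    calc 2 * (K : ℝ) + 1 ≤ 2 ^ 10 * Λ ^ 2 := by nlinarith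
      _ ≤ Λ ^ 10 * Λ ^ 2 := by gcongr
      _ = Λ ^ 12 := by ring
  have hexp : Real.exp (-(ε ^ 2 * m / 2048)) ≤ (Λ ^ (15 * d))⁻¹ := by
    rw [← Real.exp_log (pow_pos hΛ0 (15 * d)), ← Real.exp_neg, Real.exp_le_exp, Real.log_pow,
      neg_le_neg_iff, le_div_iff₀ (by norm_num)]
    have := mul_le_mul_of_nonneg_left hm (sq_nonneg ε)
    refine le_trans (le_of_eq ?_) this
    push_cast
    field_simp
    ring
  have hcount : 2 * (2 * (K : ℝ) + 1) ^ d + 1 ≤ Λ ^ (14 * d) := by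
    have h1 : (2 * (K : ℝ) + 1) ^ d ≤ Λ ^ (12 * d) := by
      rw [pow_mul]
      gcongr
    have h2 : (2 : ℝ) ^ 2 ≤ Λ ^ (2 * d) := by
      calc (2 : ℝ) ^ 2 ≤ Λ ^ 2 := by gcongr
        _ ≤ Λ ^ (2 * d) := pow_le_pow_right₀ hΛ1 (by omega)
    have h3 : 1 ≤ Λ ^ (12 * d) := one_le_pow₀ hΛ1
    calc 2 * (2 * (K : ℝ) + 1) ^ d + 1 ≤ 2 ^ 2 * Λ ^ (12 * d) := by linarith
      _ ≤ Λ ^ (2 * d) * Λ ^ (12 * d) := by gcongr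
      _ = Λ ^ (14 * d) := by ring
  calc (2 * (2 * (K : ℝ) + 1) ^ d + 1) * Real.exp (-(ε ^ 2 * m / 2048))
      ≤ Λ ^ (14 * d) * (Λ ^ (15 * d))⁻¹ := by gcongr
    _ = (Λ ^ d)⁻¹ := by
      rw [show 15 * d = 14 * d + d by ring, pow_add, mul_inv, mul_inv_cancel_left₀ (by positivity)]
    _ ≤ (Λ ^ 1)⁻¹ := by gcongr
    _ ≤ δ := by
      rw [pow_one, hΛ, inv_div, div_le_iff₀ (by linarith)]
      nlinarith

lemma exists_forall_le_exp_neg_le : ∃ M : ℕ, ∀ m : ℕ, M ≤ m → ∀ ε : ℝ, 1 / 2 < ε →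
    5000 * Real.exp (-(ε ^ 2 * m / 2048)) ≤ 1 / 2 := by
  obtain ⟨M, hM⟩ := exists_nat_ge (8192 * Real.log 10000)
  refine ⟨M, fun m hm ε hε => ?_⟩
  have hm' : (M : ℝ) ≤ m := by exact_mod_cast hm
  have hm0 : (0 : ℝ) ≤ m := by positivity
  have h : Real.exp (-(ε ^ 2 * m / 2048)) ≤ Real.exp (-Real.log 10000) := by
    rw [Real.exp_le_exp, neg_le_neg_iff, le_div_iff₀ (by norm_num)]
    have h4 : 1 / 4 ≤ ε ^ 2 := by nlinarith
    nlinarith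
  rw [Real.exp_neg (Real.log 10000), Real.exp_log (by norm_num)] at h
  linarith

/-- ℓ₁ subspace embedding by i.i.d. Cauchy sketches: with `m ≳ (d/ε²) log(d/(εδ))` rows of
i.i.d. standard Cauchy entries, with probability at least `1 − δ`, simultaneously for all
`x` in a fixed `d`-dimensional subspace `L ⊆ ℝⁿ`,
`(1−ε)‖x‖₁ ≤ ‖Ax‖_med ≤ (1+ε)‖x‖₁`. -/
theorem stmt_11 : ∃ C : ℝ, 0 < C ∧
    ∀ (n d : ℕ), 1 ≤ d → d ≤ n →
    ∀ ε δ : ℝ, 0 < ε → ε < 1 → 0 < δ → δ < 1 →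
    ∀ m : ℕ, C * ((d : ℝ) / ε ^ 2) * Real.log ((d : ℝ) / (ε * δ)) ≤ m →
    ∀ L : Submodule ℝ (Fin n → ℝ), Module.finrank ℝ L = d →
    1 - δ ≤
      ((Measure.pi fun _ : Fin m × Fin n => cauchyMeasure)
        {ω | ∀ x ∈ L,
          (1 - ε) * (∑ i, |x i|) ≤ medNorm (fun i : Fin m => ∑ j, ω (i, j) * x j) ∧
          medNorm (fun i : Fin m => ∑ j, ω (i, j) * x j) ≤ (1 + ε) * (∑ i, |x i|)}).toReal := by
  obtain ⟨M, hM⟩ := exists_forall_le_exp_neg_le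
  refine ⟨30720 + M * 8 ^ M, by positivity, ?_⟩
  intro n d hd _ ε δ hε hε1 hδ hδ1 m hm L hL
  have hd1 : (1 : ℝ) ≤ d := by exact_mod_cast hd
  suffices h : 1 - δ ≤
      (Measure.pi fun _ : Fin m => Measure.pi fun _ : Fin n => cauchyMeasure).real
        (medianEmbeddingEvent m L ε) by
    refine h.trans (ENNReal.toReal_mono (measure_ne_top _ _) ?_)
    rw [← map_uncurry_pi_cauchyMeasure]
    exact Measure.le_map_apply (Measurable.aemeasurable (by fun_prop)) _
  have hεδ : 0 < ε * δ := by positivity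
  have hεδ1 : ε * δ < 1 := by nlinarith
  have hΛ : 1 < (d : ℝ) / (ε * δ) := by
    rw [lt_div_iff₀ hεδ]
    linarith
  have hlog : 0 < Real.log ((d : ℝ) / (ε * δ)) := Real.log_pos hΛ
  set K := ⌈256 * (d : ℝ) ^ 2 / ε ^ 2⌉₊ with hKdef
  have hK : 256 * (d : ℝ) ^ 2 / ε ^ 2 ≤ K := Nat.le_ceil _
  have hK' : (K : ℝ) ≤ 257 * d ^ 2 / ε ^ 2 := by
    have h1 : (K : ℝ) ≤ 256 * d ^ 2 / ε ^ 2 + 1 := (Nat.ceil_lt_add_one (by positivity)).le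
    have h2 : 1 ≤ (d : ℝ) ^ 2 / ε ^ 2 := by
      rw [le_div_iff₀ (by positivity)]
      nlinarith
    rw [mul_div_assoc] at h1 ⊢
    linarith
  have hfail := pi_cauchyMeasure_real_compl_le (m := m) hd hε hε1 hL hK
  have hm0 : (0 : ℝ) < m := lt_of_lt_of_le (by positivity) hm
  rcases le_or_gt 2 ((d : ℝ) / (ε * δ)) with hlarge | hsmall
  · refine one_sub_le_pi_cauchyMeasure_real (hfail.trans
      (grid_mul_exp_le hd hε hε1 hδ hδ1 hlarge hK' (le_trans ?_ hm)))
    gcongr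
    exact le_add_of_nonneg_right (by positivity)
  · rw [div_lt_iff₀ hεδ] at hsmall
    obtain rfl : d = 1 := by
      have : (d : ℝ) < 2 := by linarith
      have : d < 2 := by exact_mod_cast this
      omega
    have hε2 : 1 / 2 < ε := by push_cast at hsmall; nlinarith
    have hδ2 : 1 / 2 < δ := by push_cast at hsmall; nlinarith
    rcases le_or_gt M m with hMm | hmM
    · refine one_sub_le_pi_cauchyMeasure_real (hfail.trans (le_trans ?_ ((hM m hMm ε hε2).trans
        hδ2.le)))
      gcongr
      have : (K : ℝ) ≤ 1028 := by
        refine hK'.trans ?_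
        rw [div_le_iff₀ (by positivity)]
        push_cast
        nlinarith
      linarith
    · refine le_trans ?_ (le_pi_cauchyMeasure_real_of_finrank_eq_one
        (by exact_mod_cast hm0) hε2 hL)
      have hlogδ : 1 - δ ≤ Real.log (((1 : ℕ) : ℝ) / (ε * δ)) := by
        have := Real.log_le_sub_one_of_pos hεδ
        rw [Nat.cast_one, one_div, Real.log_inv]
        nlinarith
      have hε3 : 1 ≤ ((1 : ℕ) : ℝ) / ε ^ 2 := by
        rw [Nat.cast_one, le_div_iff₀ (by positivity)]
        nlinarith
      have hmM' : (m : ℝ) ≤ M := by exact_mod_cast hmM.le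
      have hM0 : (0 : ℝ) < M := hm0.trans_le hmM'
      have hle : (M * 8 ^ M : ℝ) * (1 - δ) ≤ M := by
        calc (M * 8 ^ M : ℝ) * (1 - δ) = M * 8 ^ M * 1 * (1 - δ) := by ring
          _ ≤ (30720 + M * 8 ^ M) * (((1 : ℕ) : ℝ) / ε ^ 2) *
              Real.log (((1 : ℕ) : ℝ) / (ε * δ)) := by
            gcongr
            linarith
          _ ≤ M := hm.trans hmM'
      rw [mul_assoc, mul_le_iff_le_one_right hM0] at hle
      calc 1 - δ ≤ 1 / 8 ^ M := by
            rw [le_div_iff₀ (by positivity)]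
            linarith
        _ = (1 / 8) ^ M := by rw [div_pow, one_pow]
        _ ≤ (1 / 8) ^ m := pow_le_pow_of_le_one (by norm_num) (by norm_num) hmM.le
end
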